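/- arXiv:2201.06158 — 4 statements merged into one kernel-verified Lean document; each statement's English description precedes it below -/
import Mathlib

section
/- (Uniform L∞-boundedness of optimal controls, real-valued case.) Assume the Lagrangian Λ is real valued and satisfies Condition (S). Fix δ ∈ [t₀,T[, δ* ≥ 0, x* ∈ ℝⁿ, B ≥ 0 and χ ∈ {e,u,∞}, and assume Λ satisfies the growth condition (H_B^δ(χ)). Then there exist constants ν̄ > 0 and ℓ ≥ 0, depending only on δ, B, δ*, x* and the problem data, such that: for every t ∈ [t₀,δ], every x in the closed ball of center x* and radius δ* in ℝⁿ, and every W^{1,1}-weak optimal pair (y_*,u_*) for (P_{t,x}) with ∫_t^T Λ(s,y_*(s),u_*(s)) ds ≤ B, one has |u_*(s)| ≤ ν̄ for a.e. s ∈ [t,T] and y_* is Lipschitz on [t,T] with Lipschitz constant at most ℓ. -/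
open MeasureTheory Set

noncomputable section

abbrev En (n : ℕ) : Type := EuclideanSpace ℝ (Fin n)

attribute [local instance] Classical.propDecidable

/-- `Φ(B) := κB + (A/α)(B + d(T−t₀)) + ‖γ‖_{L¹([t₀,T])}`. -/
def PhiB (α d κ A t₀ T : ℝ) (γ : ℝ → ℝ) (B : ℝ) : ℝ :=
  κ * B + (A / α) * (B + d * (T - t₀)) + ∫ s in t₀..T, |γ s|

/-- The convex subdifferential at `μ = 1` of the map `μ ∈ ]0,∞[ ↦ Λ(s,y,u/μ)·μ`:
the set of `p ∈ ℝ` with `Λ(s,y,u/μ)·μ ≥ Λ(s,y,u) + p(μ−1)` for all `μ > 0`. -/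
def subdiffMu {n m : ℕ} (Λ : ℝ → En n → En m → EReal) (s : ℝ) (y : En n) (u : En m) :
    Set ℝ :=
  {p : ℝ | ∀ μ : ℝ, 0 < μ →
    Λ s y u + ((p * (μ - 1) : ℝ) : EReal) ≤ Λ s y (μ⁻¹ • u) * ((μ : ℝ) : EReal)}

/-- The convex subdifferential at `r = 1` of the map `r ∈ ]0,∞[ ↦ Λ(s,y,ru)`:
the set of `q ∈ ℝ` with `Λ(s,y,ru) ≥ Λ(s,y,u) + q(r−1)` for all `r > 0`. -/
def subdiffR {n m : ℕ} (Λ : ℝ → En n → En m → EReal) (s : ℝ) (y : En n) (u : En m) :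
    Set ℝ :=
  {q : ℝ | ∀ r : ℝ, 0 < r →
    Λ s y u + ((q * (r - 1) : ℝ) : EReal) ≤ Λ s y (r • u)}

/-- The three distances: Euclidean (`e`), `u`-distance (`u`), infinity distance (`infty`). -/
inductive Chi | e | u | infty

/-- The distance `dist_χ` on `[t₀,T]×ℝⁿ×ℝᵐ`, with values in `EReal` (the `u`- and
`∞`-distances take the value `+∞`). -/
def distChi {n m : ℕ} : Chi → (ℝ × En n × En m) → (ℝ × En n × En m) → EReal
  | Chi.e, ω₁, ω₂ =>
      ((Real.sqrt ((ω₂.1 - ω₁.1) ^ 2 + ‖ω₂.2.1 - ω₁.2.1‖ ^ 2 + ‖ω₂.2.2 - ω₁.2.2‖ ^ 2) : ℝ) :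
        EReal)
  | Chi.u, ω₁, ω₂ =>
      if ω₁.1 = ω₂.1 ∧ ω₁.2.1 = ω₂.2.1 then ((‖ω₂.2.2 - ω₁.2.2‖ : ℝ) : EReal) else ⊤
  | Chi.infty, ω₁, ω₂ => if ω₁ = ω₂ then (0 : EReal) else ⊤

/-- `dist_χ(ω, Dom(Λ)ᶜ)`: distance from `ω` to the complement of `Dom(Λ)` inside
`[t₀,T]×ℝⁿ×ℝᵐ` (`= +∞` if the complement is empty). -/
def distToCompl {n m : ℕ} (χ : Chi) (t₀ T : ℝ) (Λ : ℝ → En n → En m → EReal)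
    (ω : ℝ × En n × En m) : EReal :=
  ⨅ ω' ∈ {ω' : ℝ × En n × En m | ω'.1 ∈ Icc t₀ T ∧ Λ ω'.1 ω'.2.1 ω'.2.2 = ⊤},
    distChi χ ω ω'

/-- `c_t(B) := (B + d(T−t))/(α(T−t))`. -/
def cB (α d T t B : ℝ) : ℝ := (B + d * (T - t)) / (α * (T - t))

/-- The set of values `P(s,y,u) ∈ ∂_μ(Λ(s,y,u/μ)μ)_{μ=1}` over `s ∈ [t₀,T]`, `|y| ≤ K`,
`u ∈ U`, `|u| ≥ ν`, `Λ(s,y,u) < +∞`, appearing in the `sup` of Condition (H). -/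
def HsupSet {n m : ℕ} (t₀ T : ℝ) (Λ : ℝ → En n → En m → EReal) (U : Set (En m))
    (K ν : ℝ) : Set EReal :=
  {P : EReal | ∃ s ∈ Icc t₀ T, ∃ y : En n, ‖y‖ ≤ K ∧ ∃ u ∈ U, ν ≤ ‖u‖ ∧ Λ s y u ≠ ⊤ ∧
    ∃ p ∈ subdiffMu Λ s y u, P = ((p : ℝ) : EReal)}

/-- The set of values `P(s,y,u) ∈ ∂_μ(Λ(s,y,u/μ)μ)_{μ=1}` over `s ∈ [t₀,T]`, `|y| ≤ K`,
`u ∈ U`, `|u| < c`, `Λ(s,y,u) < +∞`, `dist_χ((s,y,u), Dom(Λ)ᶜ) ≥ ρ`, appearing in the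
`inf` of Condition (H). -/
def HinfSet {n m : ℕ} (χ : Chi) (t₀ T : ℝ) (Λ : ℝ → En n → En m → EReal) (U : Set (En m))
    (K c ρ : ℝ) : Set EReal :=
  {P : EReal | ∃ s ∈ Icc t₀ T, ∃ y : En n, ‖y‖ ≤ K ∧ ∃ u ∈ U, ‖u‖ < c ∧ Λ s y u ≠ ⊤ ∧
    ((ρ : ℝ) : EReal) ≤ distToCompl χ t₀ T Λ (s, y, u) ∧
    ∃ p ∈ subdiffMu Λ s y u, P = ((p : ℝ) : EReal)}

/-- Growth Condition (H_B^δ(χ)): for every `K ≥ 0` there are `ν̄ > 0` and `c > c_δ(B)`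
such that for all `ρ > 0`,
`sup {P(s,y,u) : |u| ≥ ν̄} + Φ(B) < inf {P(s,y,u) : |u| < c, dist_χ(·, Dom(Λ)ᶜ) ≥ ρ}`. -/
def ConditionH {n m : ℕ} (χ : Chi) (t₀ T α d κ A : ℝ) (γ : ℝ → ℝ)
    (Λ : ℝ → En n → En m → EReal) (U : Set (En m)) (δ B : ℝ) : Prop :=
  ∀ K : ℝ, 0 ≤ K → ∃ ν : ℝ, 0 < ν ∧ ∃ c : ℝ, cB α d T δ B < c ∧
    ∀ ρ : ℝ, 0 < ρ →
      sSup (HsupSet t₀ T Λ U K ν) + ((PhiB α d κ A t₀ T γ B : ℝ) : EReal) <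
        sInf (HinfSet χ t₀ T Λ U K c ρ)

/-- Condition (S): a local Lipschitz condition in the time variable, with constants
`κ, A ≥ 0`, `γ ∈ L¹([t₀,T])` and `ε > 0`. -/
def ConditionS {n m : ℕ} (t₀ T : ℝ) (Λ : ℝ → En n → En m → EReal)
    (κ A : ℝ) (γ : ℝ → ℝ) (ε : ℝ) : Prop :=
  0 ≤ κ ∧ 0 ≤ A ∧ IntegrableOn γ (Icc t₀ T) ∧ 0 < ε ∧
    ∀ᵐ s ∂(volume : Measure ℝ), s ∈ Icc t₀ T →
      ∀ s₁ s₂ : ℝ, ∀ y : En n, ∀ u : En m,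
        s₁ ∈ Icc (s - ε) (s + ε) ∩ Icc t₀ T → s₂ ∈ Icc (s - ε) (s + ε) ∩ Icc t₀ T →
        Λ s₁ y u ≠ ⊤ → Λ s₂ y u ≠ ⊤ →
        ((|(Λ s₂ y u).toReal - (Λ s₁ y u).toReal| : ℝ) : EReal) ≤
          (((κ : ℝ) : EReal) * Λ s y u + ((A * ‖u‖ + γ s : ℝ) : EReal)) *
            ((|s₂ - s₁| : ℝ) : EReal)

/-- An admissible pair `(y, u)` for the Bolza problem (P_{t,x}):
`y` is absolutely continuous on `[t,T]` (encoded by the integral formula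
`y s = x + ∫_t^s b(y τ) (u τ) dτ`, so that `y' = b(y)u` a.e. and `y t = x`),
`u` is measurable with values in the cone `U` a.e., the state constraint `y s ∈ S` holds,
and `J_t(y,u) = ∫_t^T Λ(s, y s, u s) ds + g (y T) < +∞`. -/
def IsAdmissible {n m : ℕ} (t₀ T : ℝ) (Λ : ℝ → En n → En m → EReal)
    (b : En n → (En m →L[ℝ] En n)) (S : Set (En n)) (U : Set (En m)) (g : En n → EReal)
    (t : ℝ) (x : En n) (y : ℝ → En n) (u : ℝ → En m) : Prop :=
  Measurable u ∧
  y t = x ∧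
  (∀ s ∈ Icc t T, y s ∈ S) ∧
  (∀ᵐ s ∂(volume : Measure ℝ), s ∈ Icc t T → u s ∈ U) ∧
  IntervalIntegrable (fun s => b (y s) (u s)) volume t T ∧
  (∀ s ∈ Icc t T, y s = x + ∫ τ in t..s, b (y τ) (u τ)) ∧
  (∀ᵐ s ∂(volume : Measure ℝ), s ∈ Icc t T → Λ s (y s) (u s) ≠ ⊤) ∧
  IntervalIntegrable (fun s => (Λ s (y s) (u s)).toReal) volume t T ∧
  g (y T) ≠ ⊤

/-- The Bolza cost `J_t(y,u) = ∫_t^T Λ(s, y s, u s) ds + g (y T)`, as an extended real. -/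
def Jcost {n m : ℕ} (T : ℝ) (Λ : ℝ → En n → En m → EReal) (g : En n → EReal)
    (t : ℝ) (y : ℝ → En n) (u : ℝ → En m) : EReal :=
  (((∫ s in t..T, (Λ s (y s) (u s)).toReal) : ℝ) : EReal) + g (y T)

/-- `(y,u)` is a `W^{1,1}`-weak optimal pair for (P_{t,x}): it is admissible and, for some
`ε > 0`, `J_t(y,u) ≤ J_t(y',u')` for every admissible pair `(y',u')` with
`‖y' − y‖_{L¹} + ‖(y')' − y'‖_{L¹} ≤ ε` (recall `y' = b(y)u` a.e.). -/
def IsWeakOptimal {n m : ℕ} (t₀ T : ℝ) (Λ : ℝ → En n → En m → EReal)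
    (b : En n → (En m →L[ℝ] En n)) (S : Set (En n)) (U : Set (En m)) (g : En n → EReal)
    (t : ℝ) (x : En n) (y : ℝ → En n) (u : ℝ → En m) : Prop :=
  IsAdmissible t₀ T Λ b S U g t x y u ∧
    ∃ ε : ℝ, 0 < ε ∧ ∀ (y' : ℝ → En n) (u' : ℝ → En m),
      IsAdmissible t₀ T Λ b S U g t x y' u' →
      (∫ s in t..T, ‖y' s - y s‖) + (∫ s in t..T, ‖b (y' s) (u' s) - b (y s) (u s)‖) ≤ ε →
      Jcost T Λ g t y u ≤ Jcost T Λ g t y' u'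

/-- `(y,u)` is a (global) optimal pair for (P_{t,x}). -/
def IsOptimal {n m : ℕ} (t₀ T : ℝ) (Λ : ℝ → En n → En m → EReal)
    (b : En n → (En m →L[ℝ] En n)) (S : Set (En n)) (U : Set (En m)) (g : En n → EReal)
    (t : ℝ) (x : En n) (y : ℝ → En n) (u : ℝ → En m) : Prop :=
  IsAdmissible t₀ T Λ b S U g t x y u ∧
    ∀ (y' : ℝ → En n) (u' : ℝ → En m), IsAdmissible t₀ T Λ b S U g t x y' u' →
      Jcost T Λ g t y u ≤ Jcost T Λ g t y' u'

/-- A real-valued Lagrangian, seen as extended-real valued. -/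
def toE {n m : ℕ} (Λ : ℝ → En n → En m → ℝ) : ℝ → En n → En m → EReal :=
  fun s y u => ((Λ s y u : ℝ) : EReal)

open Filter Topology

/-- Boxes in Baire space are compact. -/
theorem isCompact_box (N : ℕ → ℕ) : IsCompact {x : ℕ → ℕ | ∀ i, x i ≤ N i} := by
  convert isCompact_univ_pi fun i => (Set.finite_Iic (N i)).isCompact using 1
  ext x
  simp [Pi.le_def]

/-- In Baire space, an open set containing the box `{x | ∀ i, x i ≤ N i}` contains one of the
cylinders obtained by imposing only finitely many of the bounds. -/
theorem exists_cylinder_subset_of_box_subset (N : ℕ → ℕ) {W : Set (ℕ → ℕ)} (hW : IsOpen W)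
    (hsub : {x : ℕ → ℕ | ∀ i, x i ≤ N i} ⊆ W) :
    ∃ k, {x : ℕ → ℕ | ∀ i < k, x i ≤ N i} ⊆ W := by
  by_contra! hcon
  have hex : ∀ k, ∃ x : ℕ → ℕ, (∀ i < k, x i ≤ N i) ∧ x ∉ W := fun k => by
    obtain ⟨x, hx, hxW⟩ := Set.not_subset.1 (hcon k)
    exact ⟨x, hx, hxW⟩
  choose x hx hxW using hex
  obtain ⟨z, hz, φ, hφ, hlim⟩ := (isCompact_box N).tendsto_subseq (x := fun k i => min (x k i) (N i))
    fun k i => min_le_right _ _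
  have hlim' : Tendsto (fun k => x (φ k)) atTop (𝓝 z) := by
    rw [tendsto_pi_nhds] at hlim ⊢
    intro i
    refine (hlim i).congr' ?_
    filter_upwards [eventually_gt_atTop i] with k hk
    exact min_eq_left (hx (φ k) i (hk.trans_le (hφ.id_le k)))
  obtain ⟨k, hk⟩ := (hlim'.eventually (hW.mem_nhds (hsub hz))).exists
  exact hxW _ hk

/-- The image of Baire space under a continuous map of positive outer measure contains the image
of a compact set of positive measure. -/
theorem exists_isCompact_measure_image_ne_zero {X : Type*} [TopologicalSpace X]
    [MeasurableSpace X] (μ : Measure X) [μ.OuterRegular]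
    (h : (ℕ → ℕ) → X) (hh : Continuous h) (hpos : μ (range h) ≠ 0) :
    ∃ K : Set (ℕ → ℕ), IsCompact K ∧ μ (h '' K) ≠ 0 := by
  obtain ⟨r, hr0, hr⟩ := exists_between (pos_iff_ne_zero.2 hpos)
  have hstep : ∀ (k : ℕ) (C : {C : Set (ℕ → ℕ) // r < μ (h '' C)}),
      ∃ n : ℕ, r < μ (h '' (C.1 ∩ {x | x k ≤ n})) := by
    rintro k ⟨C, hC⟩
    have hun : h '' C = ⋃ n : ℕ, h '' (C ∩ {x | x k ≤ n}) := by
      rw [← image_iUnion, ← inter_iUnion]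
      congr 1
      refine (inter_eq_left.2 fun x _ => ?_).symm
      exact mem_iUnion.2 ⟨x k, le_refl (x k)⟩
    have hmono : Monotone fun n : ℕ => h '' (C ∩ {x | x k ≤ n}) := fun a b hab =>
      image_mono (inter_subset_inter_right _ fun x (hx : x k ≤ a) => hx.trans hab)
    rw [hun, hmono.directed_le.measure_iUnion] at hC
    exact lt_iSup_iff.1 hC
  choose n hn using hstep
  let C : ℕ → {C : Set (ℕ → ℕ) // r < μ (h '' C)} := fun k =>
    Nat.rec ⟨univ, by rwa [image_univ]⟩ (fun k C => ⟨_, hn k C⟩) k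
  have hCsucc : ∀ k, (C (k + 1)).1 = (C k).1 ∩ {x | x k ≤ n k (C k)} := fun k => rfl
  let N : ℕ → ℕ := fun k => n k (C k)
  have hC : ∀ k, (C k).1 = {x | ∀ i < k, x i ≤ N i} := by
    intro k
    induction k with
    | zero => ext x; simp [C]
    | succ k ih =>
      rw [hCsucc, ih]
      ext x
      simp only [mem_inter_iff, mem_ofPred_eq, Nat.lt_succ_iff_lt_or_eq, or_imp, forall_and,
        forall_eq]
      rfl
  refine ⟨_, isCompact_box N, fun h0 => ?_⟩
  obtain ⟨V, hV, hVo, hVr⟩ := Set.exists_isOpen_lt_of_lt (μ := μ) (h '' {x | ∀ i, x i ≤ N i}) r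
    (h0 ▸ hr0)
  obtain ⟨k, hk⟩ := exists_cylinder_subset_of_box_subset N (hVo.preimage hh)
    (image_subset_iff.1 hV)
  have := (C k).2
  rw [hC k] at this
  exact absurd (this.trans_le (measure_mono (image_subset_iff.2 hk))) hVr.not_gt

/-- A compact planar set admits a measurable selection over its projection. -/
theorem IsCompact.exists_measurable_selection {Q : Set (ℝ × ℝ)} (hQ : IsCompact Q) :
    ∃ m : ℝ → ℝ, Measurable m ∧ ∀ s ∈ Prod.fst '' Q, (s, m s) ∈ Q := by
  classical
  have hfib : ∀ s, IsCompact {v | (s, v) ∈ Q} := fun s => by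
    have h1 : IsCompact (Prod.snd '' (Q ∩ Prod.fst ⁻¹' {s})) :=
      (hQ.inter_right (isClosed_singleton.preimage continuous_fst)).image continuous_snd
    convert h1 using 1
    ext v
    simp [Prod.exists]
  have hsel : ∀ s ∈ Prod.fst '' Q, sInf {v | (s, v) ∈ Q} ∈ {v | (s, v) ∈ Q} := by
    rintro s ⟨⟨s', v⟩, hv, rfl⟩
    exact (hfib s').sInf_mem ⟨v, hv⟩
  have hmeas : MeasurableSet (Prod.fst '' Q) := (hQ.image continuous_fst).isClosed.measurableSet
  refine ⟨fun s => if s ∈ Prod.fst '' Q then sInf {v | (s, v) ∈ Q} else 0, ?_, fun s hs => ?_⟩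
  · refine measurable_of_restrict_of_restrict_compl hmeas ?_ ?_
    · refine measurable_of_Iic fun a => ?_
      have hcl : IsClosed (Prod.fst '' (Q ∩ Prod.snd ⁻¹' Iic a)) :=
        ((hQ.inter_right (isClosed_Iic.preimage continuous_snd)).image continuous_fst).isClosed
      convert hcl.measurableSet.preimage (measurable_subtype_coe (p := (· ∈ Prod.fst '' Q)))
        using 1
      ext ⟨s, hs⟩
      simp only [mem_preimage, domRestrict_apply, if_pos hs, mem_Iic]
      constructor
      · intro h
        exact ⟨(s, _), ⟨hsel s hs, h⟩, rfl⟩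
      · rintro ⟨⟨s', v⟩, ⟨hv, hva⟩, rfl⟩
        exact (csInf_le (hfib s').bddBelow hv).trans hva
    · have : (Prod.fst '' Q)ᶜ.domRestrict
          (fun s => if s ∈ Prod.fst '' Q then sInf {v | (s, v) ∈ Q} else 0) = fun _ => 0 := by
        ext ⟨s, hs⟩
        exact if_neg hs
      rw [this]
      exact measurable_const
  · simp only [if_pos hs]
    exact hsel s hs

/-- A Borel planar set whose projection is not null contains the graph of a measurable function
over a measurable set of positive measure. -/
theorem MeasurableSet.exists_measurable_selection {G : Set (ℝ × ℝ)} (hG : MeasurableSet G)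
    (hpos : volume (Prod.fst '' G) ≠ 0) :
    ∃ E : Set ℝ, MeasurableSet E ∧ volume E ≠ 0 ∧
      ∃ m : ℝ → ℝ, Measurable m ∧ ∀ s ∈ E, (s, m s) ∈ G := by
  have hana := hG.analyticSet
  rw [AnalyticSet] at hana
  rcases hana with rfl | ⟨f, hf, rfl⟩
  · simp at hpos
  obtain ⟨K, hK, hKpos⟩ := exists_isCompact_measure_image_ne_zero volume
    (fun x => (f x).1) (continuous_fst.comp hf) (by rwa [← range_comp] at hpos)
  have hQ := hK.image hf
  obtain ⟨m, hm, hsel⟩ := hQ.exists_measurable_selection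
  refine ⟨Prod.fst '' (f '' K), (hQ.image continuous_fst).isClosed.measurableSet,
    by rwa [image_image], m, hm, fun s hs => ?_⟩
  exact image_subset_range _ _ (hsel s hs)

/-- `e` is the increasing homeomorphism of the line with positive density `ρ`. -/
structure IsTimeChange (ρ : ℝ → ℝ) (e : ℝ ≃o ℝ) : Prop where
  measurable : Measurable ρ
  pos : ∀ s, 0 < ρ s
  intervalIntegrable : ∀ a b, IntervalIntegrable ρ volume a b
  sub_eq : ∀ a b, e b - e a = ∫ s in a..b, ρ s

/-- A measurable function bounded between two positive constants is the density of a time change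
fixing a prescribed instant. -/
theorem exists_isTimeChange {ρ : ℝ → ℝ} (hρ : Measurable ρ) {c C : ℝ} (hc : 0 < c)
    (hcρ : ∀ s, c ≤ ρ s) (hρC : ∀ s, ρ s ≤ C) (t : ℝ) :
    ∃ e : ℝ ≃o ℝ, IsTimeChange ρ e ∧ e t = t := by
  have hyint : ∀ a b, IntervalIntegrable ρ volume a b := fun a b =>
    (intervalIntegrable_const (c := C)).mono_fun hρ.aestronglyMeasurable <|
      Eventually.of_forall fun s => by
        change ‖ρ s‖ ≤ ‖C‖
        rw [Real.norm_of_nonneg (hc.le.trans (hcρ s)), Real.norm_eq_abs]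
        exact (hρC s).trans (le_abs_self C)
  let φ : ℝ → ℝ := fun s => t + ∫ τ in t..s, ρ τ
  have hsub : ∀ a b, φ b - φ a = ∫ s in a..b, ρ s := fun a b => by
    simp only [φ, add_sub_add_left_eq_sub]
    exact intervalIntegral.integral_interval_sub_left (hyint _ _) (hyint _ _)
  have hlow : ∀ a b, a ≤ b → c * (b - a) ≤ φ b - φ a := fun a b hab => by
    have := intervalIntegral.integral_mono_on hab (intervalIntegrable_const (c := c)) (hyint a b)
      fun s _ => hcρ s
    rw [hsub]
    simpa [mul_comm] using this
  have hmono : StrictMono φ := fun a b hab => by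
    have := hlow a b hab.le
    have := mul_pos hc (sub_pos.2 hab)
    linarith
  have hcont : Continuous φ :=
    continuous_const.add (intervalIntegral.continuous_primitive hyint t)
  have hφt : φ t = t := by simp [φ]
  have htop : Tendsto φ atTop atTop := by
    refine tendsto_atTop_mono' _ ?_
      (tendsto_atTop_add_const_left _ t ((tendsto_id.atTop_add
        (tendsto_const_nhds (x := -t))).const_mul_atTop hc))
    filter_upwards [eventually_ge_atTop t] with s hs
    have := hlow t s hs
    rw [hφt] at this
    simp only [id]
    linarith
  have hbot : Tendsto φ atBot atBot := by
    refine tendsto_atBot_mono' _ ?_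
      (tendsto_atBot_add_const_left _ t ((tendsto_id.atBot_add
        (tendsto_const_nhds (x := -t))).const_mul_atBot hc))
    filter_upwards [eventually_le_atBot t] with s hs
    have := hlow s t hs
    rw [hφt] at this
    simp only [id]
    linarith
  exact ⟨hmono.orderIsoOfSurjective φ (hcont.surjective htop hbot),
    ⟨hρ, fun s => hc.trans_le (hcρ s), hyint, hsub⟩, hφt⟩

namespace IsTimeChange

variable {ρ : ℝ → ℝ} {e : ℝ ≃o ℝ} {E : Type*} [NormedAddCommGroup E] [NormedSpace ℝ E]

theorem measurableEmbedding (e : ℝ ≃o ℝ) : MeasurableEmbedding e :=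
  e.toHomeomorph.measurableEmbedding

theorem map_withDensity (h : IsTimeChange ρ e) :
    (volume.withDensity fun s => ENNReal.ofReal (ρ s)).map e = volume := by
  symm
  refine Measure.ext_of_Ioc _ _ fun a b hab => ?_
  rw [(measurableEmbedding e).map_apply, withDensity_apply _
    ((measurableEmbedding e).measurable measurableSet_Ioc), OrderIso.preimage_Ioc]
  have hab' : e.symm a ≤ e.symm b := e.symm.monotone hab.le
  rw [← ofReal_integral_eq_lintegral_ofReal
    ((h.intervalIntegrable _ _).1) (Eventually.of_forall fun s => (h.pos s).le),
    ← intervalIntegral.integral_of_le hab', ← h.sub_eq]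
  simp

theorem ae_comp_iff (h : IsTimeChange ρ e) {p : ℝ → Prop} :
    (∀ᵐ s ∂(volume : Measure ℝ), p (e s)) ↔ ∀ᵐ τ ∂(volume : Measure ℝ), p τ := by
  conv_rhs => rw [← h.map_withDensity]
  rw [(measurableEmbedding e).ae_map_iff, ae_withDensity_iff h.measurable.ennreal_ofReal]
  simp [h.pos]

theorem integral_comp (h : IsTimeChange ρ e) (G : ℝ → E) {a b : ℝ} (hab : a ≤ b) :
    ∫ s in a..b, ρ s • G (e s) = ∫ τ in e a..e b, G τ := by
  rw [intervalIntegral.integral_of_le hab, intervalIntegral.integral_of_le (e.monotone hab)]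
  conv_rhs => rw [← h.map_withDensity]
  rw [(measurableEmbedding e).setIntegral_map,
    setIntegral_withDensity_eq_setIntegral_toReal_smul h.measurable.ennreal_ofReal
      (Eventually.of_forall fun _ => ENNReal.ofReal_lt_top) _
      ((measurableEmbedding e).measurable measurableSet_Ioc), OrderIso.preimage_Ioc]
  simp [ENNReal.toReal_ofReal (h.pos _).le]

theorem intervalIntegrable_comp_iff (h : IsTimeChange ρ e) {G : ℝ → E} {a b : ℝ} (hab : a ≤ b) :
    IntervalIntegrable (fun s => ρ s • G (e s)) volume a b ↔
      IntervalIntegrable G volume (e a) (e b) := by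
  rw [intervalIntegrable_iff_integrableOn_Ioc_of_le hab,
    intervalIntegrable_iff_integrableOn_Ioc_of_le (e.monotone hab)]
  conv_rhs => rw [← h.map_withDensity]
  rw [(measurableEmbedding e).integrableOn_map_iff, IntegrableOn, IntegrableOn,
    restrict_withDensity ((measurableEmbedding e).measurable measurableSet_Ioc),
    integrable_withDensity_iff_integrable_smul' h.measurable.ennreal_ofReal
      (Eventually.of_forall fun _ => ENNReal.ofReal_lt_top), OrderIso.preimage_Ioc]
  simp [ENNReal.toReal_ofReal (h.pos _).le]

/-- `L¹`-continuity of the action of time changes at the identity. -/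
theorem exists_integral_norm_sub_le {v : ℝ → E} {t T : ℝ} (htT : t ≤ T)
    (hv : IntervalIntegrable v volume t T) {ε : ℝ} (hε : 0 < ε) :
    ∃ η > 0, ∀ (ρ : ℝ → ℝ) (e : ℝ ≃o ℝ), IsTimeChange ρ e → e t = t → e T = T →
      (∀ s ∈ Icc t T, |e s - s| ≤ η) → ∫ s in t..T, |ρ s - 1| ≤ η →
      ∫ s in t..T, ‖v s - ρ s • v (e s)‖ ≤ ε := by
  have hvI : Integrable ((Ioc t T).indicator v) :=
    (integrable_indicator_iff measurableSet_Ioc).2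
      ((intervalIntegrable_iff_integrableOn_Ioc_of_le htT).1 hv)
  obtain ⟨g, hgsupp, hgint, hgc, hgi⟩ :=
    hvI.exists_hasCompactSupport_integral_sub_le (ε := ε / 4) (by positivity)
  obtain ⟨M, hM⟩ := hgc.bounded_above_of_compact_support hgsupp
  have hM0 : 0 ≤ M := (norm_nonneg _).trans (hM 0)
  have hvg : ∫ s in t..T, ‖v s - g s‖ ≤ ε / 4 := by
    refine le_trans ?_ hgint
    rw [intervalIntegral.integral_of_le htT]
    refine le_trans (le_of_eq ?_) (setIntegral_le_integral (s := Ioc t T)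
      (hvI.sub hgi).norm (Eventually.of_forall fun s => norm_nonneg _))
    exact setIntegral_congr_fun measurableSet_Ioc fun s hs => by simp [indicator_of_mem hs]
  obtain ⟨r, hr, hgr⟩ := Metric.uniformContinuous_iff.1
    (hgsupp.uniformContinuous_of_continuous hgc) (ε / (4 * (T - t + 1)))
    (by have := sub_nonneg.2 htT; positivity)
  refine ⟨min (r / 2) (ε / (4 * (M + 1))), by positivity, fun ρ e h het heT hes hρ => ?_⟩
  have hgI : IntervalIntegrable g volume t T := hgi.intervalIntegrable
  have i1 : IntervalIntegrable (fun s => ‖v s - g s‖) volume t T := (hv.sub hgI).norm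
  have i2 : IntervalIntegrable (fun s => ρ s • ‖v (e s) - g (e s)‖) volume t T := by
    rw [h.intervalIntegrable_comp_iff (G := fun s => ‖v s - g s‖) htT, het, heT]
    exact i1
  have i3 : IntervalIntegrable (fun s => |ρ s - 1| * M) volume t T :=
    (((h.intervalIntegrable t T).sub intervalIntegrable_const).abs).mul_const M
  have e2 : ∫ s in t..T, ρ s • ‖v (e s) - g (e s)‖ ≤ ε / 4 := by
    rw [h.integral_comp (fun s => ‖v s - g s‖) htT, het, heT]
    exact hvg
  have e3 : ∫ s in t..T, |ρ s - 1| * M ≤ ε / 4 := by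
    rw [intervalIntegral.integral_mul_const]
    have h1 := hρ.trans (min_le_right _ _)
    calc _ ≤ ε / (4 * (M + 1)) * M := by gcongr
      _ ≤ ε / (4 * (M + 1)) * (M + 1) := by gcongr; linarith
      _ = ε / 4 := by field_simp
  have iv : IntervalIntegrable (fun s => ρ s • v (e s)) volume t T := by
    rw [h.intervalIntegrable_comp_iff htT, het, heT]
    exact hv
  have hpt : ∀ s ∈ Icc t T, ‖v s - ρ s • v (e s)‖ ≤
      ‖v s - g s‖ + ε / (4 * (T - t + 1)) + |ρ s - 1| * M + ρ s • ‖v (e s) - g (e s)‖ := by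
    intro s hs
    have hclose : ‖g s - g (e s)‖ ≤ ε / (4 * (T - t + 1)) := by
      rw [← dist_eq_norm]
      refine (hgr ?_).le
      rw [dist_comm, Real.dist_eq]
      exact ((hes s hs).trans (min_le_left _ _)).trans_lt (by linarith)
    have hdec : v s - ρ s • v (e s) = (v s - g s) + (g s - g (e s)) + (1 - ρ s) • g (e s)
        - ρ s • (v (e s) - g (e s)) := by
      rw [sub_smul, one_smul, smul_sub]
      abel
    calc ‖v s - ρ s • v (e s)‖
        ≤ ‖v s - g s‖ + ‖g s - g (e s)‖ + ‖(1 - ρ s) • g (e s)‖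
          + ‖ρ s • (v (e s) - g (e s))‖ := by
          rw [hdec]
          exact (norm_sub_le _ _).trans (add_le_add_left (norm_add₃_le ..) _)
      _ ≤ _ := by
          rw [norm_smul, norm_smul, Real.norm_eq_abs, Real.norm_of_nonneg (h.pos s).le,
            abs_sub_comm, smul_eq_mul]
          gcongr
          exact hM _
  calc ∫ s in t..T, ‖v s - ρ s • v (e s)‖
      ≤ ∫ s in t..T, (‖v s - g s‖ + ε / (4 * (T - t + 1)) + |ρ s - 1| * M
          + ρ s • ‖v (e s) - g (e s)‖) :=
        intervalIntegral.integral_mono_on htT (hv.sub iv).norm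
          (((i1.add intervalIntegrable_const).add i3).add i2) hpt
    _ = (∫ s in t..T, ‖v s - g s‖) + (T - t) * (ε / (4 * (T - t + 1)))
          + (∫ s in t..T, |ρ s - 1| * M) + ∫ s in t..T, ρ s • ‖v (e s) - g (e s)‖ := by
        rw [intervalIntegral.integral_add ((i1.add intervalIntegrable_const).add i3) i2,
          intervalIntegral.integral_add (i1.add intervalIntegrable_const) i3,
          intervalIntegral.integral_add i1 intervalIntegrable_const,
          intervalIntegral.integral_const, smul_eq_mul]
    _ ≤ ε / 4 + ε / 4 + ε / 4 + ε / 4 := by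
        have h4 : (T - t) * (ε / (4 * (T - t + 1))) ≤ ε / 4 := by
          have h0 := sub_nonneg.2 htT
          calc _ ≤ (T - t + 1) * (ε / (4 * (T - t + 1))) := by gcongr; linarith
            _ = ε / 4 := by field_simp
        linarith
    _ = ε := by ring

end IsTimeChange

/-- A measurable function is bounded on a large enough part of a set of positive measure. -/
theorem exists_nat_measure_inter_le_ne_zero {A : Set ℝ} (hA : volume A ≠ 0) (F : ℝ → ℝ) :
    ∃ N : ℕ, volume (A ∩ {s | F s ≤ N}) ≠ 0 := by
  by_contra! h
  refine hA (measure_mono_null (fun s hs => ?_) (measure_iUnion_null h))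
  obtain ⟨N, hN⟩ := exists_nat_ge (F s)
  exact mem_iUnion.2 ⟨N, hs, hN⟩

/-- A positive bounded weight on a set of positive measure can be cut down to any prescribed
small mass. -/
theorem exists_subset_integral_indicator_eq {A : Set ℝ} (hA : MeasurableSet A) {a b : ℝ}
    (hab : a ≤ b) (hAab : A ⊆ Ioc a b) (hApos : volume A ≠ 0) {w : ℝ → ℝ} (hw : Measurable w)
    (hw0 : ∀ s ∈ A, 0 < w s) {M : ℝ} (hwM : ∀ s ∈ A, w s ≤ M) :
    Integrable (A.indicator w) ∧ ∃ η₀ > 0, ∀ η ∈ Icc 0 η₀, ∃ C ⊆ A, MeasurableSet C ∧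
      ∫ s in a..b, C.indicator w s = η := by
  have hfin : volume A < ⊤ := (measure_mono hAab).trans_lt measure_Ioc_lt_top
  have hyint : Integrable (A.indicator w) := by
    rw [integrable_indicator_iff hA]
    refine Measure.integrableOn_of_bounded (M := M) hfin.ne hw.aestronglyMeasurable ?_
    filter_upwards [ae_restrict_mem hA] with s hs
    rw [Real.norm_of_nonneg (hw0 s hs).le]
    exact hwM s hs
  have hpos : 0 < ∫ s in a..b, A.indicator w s := by
    rw [intervalIntegral.integral_of_le hab, setIntegral_indicator hA,
      inter_eq_right.2 hAab, setIntegral_pos_iff_support_of_nonneg_ae]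
    · refine pos_iff_ne_zero.2 fun h0 => hApos ?_
      have hsupp : Function.support w ∩ A = A := inter_eq_right.2 fun s hs => (hw0 s hs).ne'
      rwa [hsupp] at h0
    · filter_upwards [ae_restrict_mem hA] with s hs using (hw0 s hs).le
    · exact (integrable_indicator_iff hA).1 hyint
  refine ⟨hyint, _, hpos, fun η hη => ?_⟩
  have hcont : ContinuousOn (fun p => ∫ s in a..p, A.indicator w s) (Icc a b) :=
    (intervalIntegral.continuous_primitive (fun _ _ => hyint.intervalIntegrable) a).continuousOn
  obtain ⟨p, hp, hpη⟩ := intermediate_value_Icc hab hcont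
    (by simpa only [intervalIntegral.integral_same] using hη)
  refine ⟨A ∩ Iic p, inter_subset_left, hA.inter measurableSet_Iic, ?_⟩
  rw [← hpη]
  have hind : (A ∩ Iic p).indicator w = (Iic p).indicator (A.indicator w) := by
    rw [indicator_indicator, inter_comm]
  simp only [hind]
  rw [intervalIntegral.integral_of_le hab, intervalIntegral.integral_of_le hp.1,
    setIntegral_indicator measurableSet_Iic, Ioc_inter_Iic, min_eq_right hp.2]

/-- The primitive of a nonnegative function supported in `Ioc a b`. -/
theorem integral_mem_Icc_of_support_subset {v : ℝ → ℝ} (hv : Integrable v) (hv0 : ∀ s, 0 ≤ v s)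
    {t a b T : ℝ} (hta : t ≤ a) (hbT : b ≤ T) (hsupp : ∀ s ∉ Ioc a b, v s = 0) :
    (∀ s ∈ Icc t T, ∫ τ in t..s, v τ ∈ Icc 0 (∫ τ in a..b, v τ)) ∧
    (∀ s ∈ Icc t a, ∫ τ in t..s, v τ = 0) ∧
    (∀ s ∈ Icc b T, ∫ τ in t..s, v τ = ∫ τ in a..b, v τ) := by
  have hii : ∀ p q, IntervalIntegrable v volume p q := fun p q => hv.intervalIntegrable
  have hleft : ∀ s ∈ Icc t a, ∫ τ in t..s, v τ = 0 := fun s hs => by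
    rw [intervalIntegral.integral_of_le hs.1]
    exact setIntegral_eq_zero_of_forall_eq_zero fun τ hτ =>
      hsupp τ fun h => absurd (hτ.2.trans hs.2) h.1.not_ge
  have hright : ∀ s ∈ Icc b T, ∫ τ in t..s, v τ = ∫ τ in a..b, v τ := fun s hs => by
    have h0 : ∫ τ in b..s, v τ = 0 := by
      rw [intervalIntegral.integral_of_le hs.1]
      exact setIntegral_eq_zero_of_forall_eq_zero fun τ hτ =>
        hsupp τ fun h => absurd h.2 hτ.1.not_ge
    rw [← intervalIntegral.integral_add_adjacent_intervals (hii t b) (hii b s), h0,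
      ← intervalIntegral.integral_add_adjacent_intervals (hii t a) (hii a b),
      hleft a ⟨hta, le_rfl⟩, zero_add, add_zero]
  refine ⟨fun s hs => ⟨intervalIntegral.integral_nonneg hs.1 fun τ _ => hv0 τ, ?_⟩, hleft, hright⟩
  rw [← hright T ⟨hbT, le_rfl⟩,
    ← intervalIntegral.integral_add_adjacent_intervals (hii t s) (hii s T)]
  have := intervalIntegral.integral_nonneg (μ := volume) hs.2 fun τ (_ : τ ∈ Icc s T) => hv0 τ
  linarith

/-- A Grönwall inequality with an integrable coefficient: the bound doubles each time the
coefficient accumulates an extra mass `1/2`. -/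
theorem add_integral_mul_le_two_pow_mul {a z : ℝ → ℝ} {t T C : ℝ} (ha : ∀ s, 0 ≤ a s)
    (hai : IntervalIntegrable a volume t T) (hz : ContinuousOn z (Icc t T)) (hz0 : ∀ s, 0 ≤ z s)
    (hle : ∀ s ∈ Icc t T, z s ≤ C + ∫ τ in t..s, a τ * z τ) (N : ℕ) :
    ∀ s ∈ Icc t T, ∫ τ in t..s, a τ ≤ N / 2 → C + ∫ τ in t..s, a τ * z τ ≤ 2 ^ N * C := by
  have hsub : ∀ p ∈ Icc t T, ∀ q ∈ Icc t T, uIcc p q ⊆ uIcc t T := fun p hp q hq =>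
    uIcc_subset_uIcc (Icc_subset_uIcc hp) (Icc_subset_uIcc hq)
  have hazi : ∀ p ∈ Icc t T, ∀ q ∈ Icc t T, IntervalIntegrable (fun τ => a τ * z τ) volume p q :=
    fun p hp q hq => (hai.mono_set (hsub p hp q hq)).mul_continuousOn
      (hz.mono (by rw [← uIcc_of_le (hp.1.trans hp.2)]; exact hsub p hp q hq))
  have hmono : ∀ p ∈ Icc t T, ∀ q ∈ Icc t T, p ≤ q →
      ∫ τ in t..p, a τ * z τ ≤ ∫ τ in t..q, a τ * z τ := fun p hp q hq hpq => by
    have ht : t ∈ Icc t T := left_mem_Icc.2 (hp.1.trans hp.2)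
    rw [← intervalIntegral.integral_add_adjacent_intervals (hazi t ht p hp) (hazi p hp q hq)]
    have := intervalIntegral.integral_nonneg (μ := volume) hpq
      fun τ (_ : τ ∈ Icc p q) => mul_nonneg (ha τ) (hz0 τ)
    linarith
  have hC : t ≤ T → 0 ≤ C := fun h => by
    have := hle t (left_mem_Icc.2 h)
    rw [intervalIntegral.integral_same, add_zero] at this
    exact (hz0 t).trans this
  have hstep : ∀ p ∈ Icc t T, ∀ q ∈ Icc t T, p ≤ q →
      ∫ τ in p..q, a τ * z τ ≤ (∫ τ in p..q, a τ) * (C + ∫ τ in t..q, a τ * z τ) := by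
    intro p hp q hq hpq
    rw [← intervalIntegral.integral_mul_const]
    refine intervalIntegral.integral_mono_on hpq (hazi p hp q hq)
      ((hai.mono_set (hsub p hp q hq)).mul_const _) fun τ hτ => ?_
    have hτ' : τ ∈ Icc t T := ⟨hp.1.trans hτ.1, hτ.2.trans hq.2⟩
    have := hmono τ hτ' q hq hτ.2
    exact mul_le_mul_of_nonneg_left ((hle τ hτ').trans (by linarith)) (ha τ)
  have hdouble : ∀ p ∈ Icc t T, ∀ q ∈ Icc t T, p ≤ q → ∫ τ in p..q, a τ ≤ 1 / 2 →
      C + ∫ τ in t..q, a τ * z τ ≤ 2 * (C + ∫ τ in t..p, a τ * z τ) := by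
    intro p hp q hq hpq hpa
    have ht : t ∈ Icc t T := left_mem_Icc.2 (hp.1.trans hp.2)
    have hF : 0 ≤ C + ∫ τ in t..q, a τ * z τ := (hz0 q).trans (hle q hq)
    have hadd := intervalIntegral.integral_add_adjacent_intervals (hazi t ht p hp) (hazi p hp q hq)
    nlinarith [hstep p hp q hq hpq]
  induction N with
  | zero =>
    intro s hs h0
    have ht : t ∈ Icc t T := left_mem_Icc.2 (hs.1.trans hs.2)
    have hnn := intervalIntegral.integral_nonneg (μ := volume) hs.1 fun τ (_ : τ ∈ Icc t s) => ha τ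
    have hle' := hstep t ht s hs hs.1
    have : ∫ τ in t..s, a τ = 0 := le_antisymm (by simpa using h0) hnn
    rw [this, zero_mul] at hle'
    simpa using hle'
  | succ N ih =>
    intro s hs hN
    have ht : t ∈ Icc t T := left_mem_Icc.2 (hs.1.trans hs.2)
    have hcont : ContinuousOn (fun s => ∫ τ in t..s, a τ) (Icc t s) := by
      rw [← uIcc_of_le hs.1]
      exact intervalIntegral.continuousOn_primitive_interval
        ((intervalIntegrable_iff' (by simp)).1 (hai.mono_set (hsub t ht s hs)))
    push_cast at hN
    by_cases hsmall : ∫ τ in t..s, a τ ≤ 1 / 2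
    · have h1 := hdouble t ht s hs hs.1 hsmall
      rw [intervalIntegral.integral_same, add_zero] at h1
      refine h1.trans (mul_le_mul_of_nonneg_right ?_ (hC ht.2))
      exact le_self_pow₀ one_le_two N.succ_ne_zero
    · obtain ⟨p, hp, hpa⟩ := intermediate_value_Icc hs.1 hcont
        (show (∫ τ in t..s, a τ) - 1 / 2 ∈ Icc (∫ τ in t..t, a τ) (∫ τ in t..s, a τ) by
          rw [intervalIntegral.integral_same]; constructor <;> linarith)
      have hp' : p ∈ Icc t T := ⟨hp.1, hp.2.trans hs.2⟩
      have hadd := intervalIntegral.integral_add_adjacent_intervals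
        (hai.mono_set (hsub t ht p hp')) (hai.mono_set (hsub p hp' s hs))
      simp only at hpa
      have h1 := hdouble p hp' s hs hp.2 (by linarith)
      have h2 := ih p hp' (by linarith)
      rw [pow_succ]
      linarith

/-- Two non-null measurable sets contain disjoint non-null measurable sets. -/
theorem exists_disjoint_measure_ne_zero {a b : ℝ} (hab : a ≤ b) {A₁ A₂ : Set ℝ}
    (hA₁ : MeasurableSet A₁) (hA₂ : MeasurableSet A₂) (hA₁ab : A₁ ⊆ Ioc a b)
    (h₁ : volume A₁ ≠ 0) (h₂ : volume A₂ ≠ 0) :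
    ∃ C₁ ⊆ A₁, ∃ C₂ ⊆ A₂, MeasurableSet C₁ ∧ MeasurableSet C₂ ∧ Disjoint C₁ C₂ ∧
      volume C₁ ≠ 0 ∧ volume C₂ ≠ 0 := by
  by_cases h12 : volume (A₁ \ A₂) = 0
  swap
  · exact ⟨_, sdiff_subset, _, Subset.rfl, hA₁.diff hA₂, hA₂, disjoint_sdiff_left, h12, h₂⟩
  obtain ⟨-, η, hη, H⟩ := exists_subset_integral_indicator_eq hA₁ hab hA₁ab h₁
    (w := fun _ => 1) measurable_const (fun _ _ => one_pos) (M := 1) fun _ _ => le_rfl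
  obtain ⟨C, hCA, hC, hCη⟩ := H (η / 2) ⟨by positivity, by linarith⟩
  obtain ⟨C', hC'A, hC', hC'η⟩ := H η ⟨hη.le, le_rfl⟩
  have hreal : ∀ {E : Set ℝ}, E ⊆ A₁ → MeasurableSet E →
      ∫ s in a..b, E.indicator (fun _ => (1 : ℝ)) s = volume.real E := fun hE hEm => by
    rw [intervalIntegral.integral_of_le hab, setIntegral_indicator hEm,
      inter_eq_right.2 (hE.trans hA₁ab), setIntegral_const, smul_eq_mul, mul_one]
  rw [hreal hCA hC] at hCη
  rw [hreal hC'A hC'] at hC'η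
  have hfin : volume A₁ ≠ ⊤ := ((measure_mono hA₁ab).trans_lt measure_Ioc_lt_top).ne
  have hCpos : volume C ≠ 0 := fun h0 => by
    rw [Measure.real, h0] at hCη
    simp only [ENNReal.toReal_zero] at hCη
    linarith
  have hdiffpos : volume (A₁ \ C) ≠ 0 := fun h0 => by
    have h1 : volume.real C' ≤ volume.real C := by
      refine ENNReal.toReal_mono (measure_ne_top_of_subset hCA hfin) ?_
      calc volume C' ≤ volume ((A₁ \ C) ∪ C) := measure_mono fun s hs => by
            by_cases hsC : s ∈ C
            · exact Or.inr hsC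
            · exact Or.inl ⟨hC'A hs, hsC⟩
        _ ≤ volume (A₁ \ C) + volume C := measure_union_le _ _
        _ = volume C := by rw [h0, zero_add]
    linarith
  refine ⟨C, hCA, (A₁ \ C) ∩ A₂, inter_subset_right, hC, (hA₁.diff hC).inter hA₂,
    disjoint_left.2 fun s hs hs' => hs'.1.2 hs, hCpos, fun h0 => hdiffpos ?_⟩
  refine measure_mono_null (fun s hs => ?_) (measure_union_null h0 h12)
  by_cases hsA : s ∈ A₂
  · exact Or.inl ⟨hs, hsA⟩
  · exact Or.inr ⟨hs.1, hsA⟩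

/-- If the slopes at `1` of a function are ordered, then the infimum of the right slopes and the
supremum of the left slopes are subgradients. -/
theorem exists_subgradient_of_slope_le {f : ℝ → ℝ}
    (hf : ∀ μ₁ > 1, ∀ μ₂ ∈ Ioo (0 : ℝ) 1, (f μ₂ - f 1) / (μ₂ - 1) ≤ (f μ₁ - f 1) / (μ₁ - 1)) :
    (∃ p, (∀ μ > 0, f 1 + p * (μ - 1) ≤ f μ) ∧
      ∀ q > p, ∃ μ > 1, f μ - f 1 ≤ q * (μ - 1)) ∧
    (∃ p, (∀ μ > 0, f 1 + p * (μ - 1) ≤ f μ) ∧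
      ∀ q < p, ∃ μ ∈ Ioo (0 : ℝ) 1, f μ - f 1 ≤ q * (μ - 1)) := by
  have hsub : ∀ p, (∀ μ > 1, p ≤ (f μ - f 1) / (μ - 1)) →
      (∀ μ ∈ Ioo (0 : ℝ) 1, (f μ - f 1) / (μ - 1) ≤ p) →
      ∀ μ > 0, f 1 + p * (μ - 1) ≤ f μ := fun p hp hp' μ hμ => by
    rcases lt_trichotomy μ 1 with h | rfl | h
    · have := hp' μ ⟨hμ, h⟩
      rw [div_le_iff_of_neg (sub_neg.2 h)] at this
      linarith
    · simp
    · have := hp μ h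
      rw [le_div_iff₀ (sub_pos.2 h)] at this
      linarith
  set R := (fun μ => (f μ - f 1) / (μ - 1)) '' Ioi 1
  set L := (fun μ => (f μ - f 1) / (μ - 1)) '' Ioo 0 1
  have hLR : ∀ l ∈ L, ∀ r ∈ R, l ≤ r := by
    rintro _ ⟨μ₂, h2, rfl⟩ _ ⟨μ₁, h1, rfl⟩
    exact hf μ₁ h1 μ₂ h2
  have hR : R.Nonempty := ⟨_, 2, by norm_num, rfl⟩
  have hL : L.Nonempty := ⟨_, 1 / 2, by norm_num, rfl⟩
  have hRb : BddBelow R := hL.elim fun l hl => ⟨l, fun r hr => hLR l hl r hr⟩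
  have hLb : BddAbove L := hR.elim fun r hr => ⟨r, fun l hl => hLR l hl r hr⟩
  refine ⟨⟨sInf R, hsub _ (fun μ hμ => csInf_le hRb ⟨μ, hμ, rfl⟩)
      fun μ hμ => le_csInf hR fun r hr => hLR _ ⟨μ, hμ, rfl⟩ r hr, fun q hq => ?_⟩,
    ⟨sSup L, hsub _ (fun μ hμ => csSup_le hL fun l hl => hLR l hl _ ⟨μ, hμ, rfl⟩)
      fun μ hμ => le_csSup hLb ⟨μ, hμ, rfl⟩, fun q hq => ?_⟩⟩
  · obtain ⟨_, ⟨μ, hμ, rfl⟩, hlt⟩ := exists_lt_of_csInf_lt hR hq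
    refine ⟨μ, hμ, ?_⟩
    rw [div_lt_iff₀ (sub_pos.2 hμ)] at hlt
    exact hlt.le
  · obtain ⟨_, ⟨μ, hμ, rfl⟩, hlt⟩ := exists_lt_of_lt_csSup hL hq
    refine ⟨μ, hμ, ?_⟩
    rw [lt_div_iff_of_neg (sub_neg.2 hμ.2)] at hlt
    exact hlt.le

/-- The cost rates `ℓ σ s r` (instant `σ`, position `s` on the trajectory, speed `r`) are
Lipschitz in `σ` near `σ = s` with rate `D s r`, and the trivial time change of `[t, T]` is a local
minimizer of the cost among the time changes fixing the end points. -/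
structure IsTimeMinimal (ℓ : ℝ → ℝ → ℝ → ℝ) (D : ℝ → ℝ → ℝ) (t T ε : ℝ) : Prop where
  lt : t < T
  pos : 0 < ε
  measurable_cost : Measurable fun p : ℝ × ℝ × ℝ => ℓ p.1 p.2.1 p.2.2
  measurable_rate : Measurable fun p : ℝ × ℝ => D p.1 p.2
  intervalIntegrable_cost : IntervalIntegrable (fun s => ℓ s s 1) volume t T
  intervalIntegrable_rate : IntervalIntegrable (fun s => D s 1) volume t T
  abs_sub_le : ∀ᵐ s ∂(volume : Measure ℝ), s ∈ Icc t T → ∀ r > 0, ∀ σ ∈ Icc t T, |σ - s| ≤ ε →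
    |ℓ σ s r - ℓ s s r| ≤ D s r * |σ - s|
  integral_le : ∀ (ρ : ℝ → ℝ) (e : ℝ ≃o ℝ), IsTimeChange ρ e → e t = t → e T = T →
    (∀ s ∈ Icc t T, |e s - s| ≤ ε) → ∫ s in t..T, |ρ s - 1| ≤ ε →
    IntervalIntegrable (fun s => ρ s * ℓ (e s) s (ρ s)) volume t T →
    ∫ s in t..T, ℓ s s 1 ≤ ∫ s in t..T, ρ s * ℓ (e s) s (ρ s)

namespace IsTimeMinimal

variable {ℓ : ℝ → ℝ → ℝ → ℝ} {D : ℝ → ℝ → ℝ} {t T ε : ℝ}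

theorem rate_nonneg (h : IsTimeMinimal ℓ D t T ε) :
    ∀ᵐ s ∂(volume : Measure ℝ), s ∈ Icc t T → ∀ r > 0, 0 ≤ D s r := by
  filter_upwards [h.abs_sub_le] with s hs hsI r hr
  obtain ⟨σ, hσI, hσs, hσε⟩ : ∃ σ ∈ Icc t T, σ ≠ s ∧ |σ - s| ≤ ε := by
    rcases hsI.2.lt_or_eq with hlt | rfl
    · have h1 : s < min T (s + ε) := lt_min hlt (by linarith [h.pos])
      refine ⟨_, ⟨hsI.1.trans h1.le, min_le_left _ _⟩, h1.ne', ?_⟩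
      rw [abs_of_pos (sub_pos.2 h1)]
      linarith [min_le_right T (s + ε)]
    · have h1 : max t (s - ε) < s := max_lt h.lt (by linarith [h.pos])
      refine ⟨_, ⟨le_max_left _ _, h1.le⟩, h1.ne, ?_⟩
      rw [abs_of_neg (sub_neg.2 h1)]
      linarith [le_max_right t (s - ε)]
  have hle := (abs_nonneg _).trans (hs hsI r hr σ hσI hσε)
  exact nonneg_of_mul_nonneg_left hle (abs_pos.2 (sub_ne_zero.2 hσs))

/-- Speeding up on `A₁` and slowing down on `A₂` by bounded amounts cannot lower the cost. -/
theorem slope_le_add_integral_of_bounded (h : IsTimeMinimal ℓ D t T ε) {a b : ℝ} (hta : t ≤ a)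
    (hab : a ≤ b) (hbT : b ≤ T) {A₁ A₂ : Set ℝ} (hA₁ : MeasurableSet A₁) (hA₂ : MeasurableSet A₂)
    (hA₁ab : A₁ ⊆ Ioc a b) (hA₂ab : A₂ ⊆ Ioc a b) (hdisj : Disjoint A₁ A₂)
    (hA₁pos : volume A₁ ≠ 0) (hA₂pos : volume A₂ ≠ 0) {μ₁ μ₂ : ℝ → ℝ} (hμ₁ : Measurable μ₁)
    (hμ₂ : Measurable μ₂) {q₁ q₂ M : ℝ} (hM : 1 ≤ M)
    (h₁ : ∀ s ∈ A₁, 1 < μ₁ s ∧ μ₁ s * ℓ s s (μ₁ s) - ℓ s s 1 ≤ q₁ * (μ₁ s - 1))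
    (h₂ : ∀ s ∈ A₂, 0 < μ₂ s ∧ μ₂ s < 1 ∧ μ₂ s * ℓ s s (μ₂ s) - ℓ s s 1 ≤ q₂ * (μ₂ s - 1))
    (hM₁ : ∀ s ∈ A₁, D s (μ₁ s) ≤ M ∧ μ₁ s ≤ M ∧ 1 ≤ M * (μ₁ s - 1) ∧ |ℓ s s (μ₁ s)| ≤ M)
    (hM₂ : ∀ s ∈ A₂, D s (μ₂ s) ≤ M ∧ 1 / M ≤ μ₂ s ∧ 1 ≤ M * (1 - μ₂ s) ∧
      |ℓ s s (μ₂ s)| ≤ M) :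
    q₂ ≤ q₁ + ∫ s in a..b, D s 1 := by
  have htT := h.lt.le
  have hM0 : 0 < M := by linarith
  obtain ⟨-, η₁, hη₁, H₁⟩ := exists_subset_integral_indicator_eq hA₁ hab hA₁ab hA₁pos
    (w := fun s => μ₁ s - 1) (hμ₁.sub_const 1) (fun s hs => sub_pos.2 (h₁ s hs).1) (M := M)
    fun s hs => by linarith [(hM₁ s hs).2.1]
  obtain ⟨-, η₂, hη₂, H₂⟩ := exists_subset_integral_indicator_eq hA₂ hab hA₂ab hA₂pos
    (w := fun s => 1 - μ₂ s) (hμ₂.const_sub 1) (fun s hs => sub_pos.2 (h₂ s hs).2.1) (M := M)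
    fun s hs => by linarith [(h₂ s hs).1]
  refine le_of_forall_pos_le_add fun ζ hζ => ?_
  obtain ⟨η, hη0, hη1', hη2', hηε, hηζ⟩ : ∃ η > 0, η ≤ η₁ ∧ η ≤ η₂ ∧ 2 * η ≤ ε ∧
      2 * M ^ 3 * η ≤ ζ := by
    refine ⟨min (min η₁ η₂) (min (ε / 2) (ζ / (2 * M ^ 3))), ?_, ?_, ?_, ?_, ?_⟩
    · have := h.pos
      positivity
    · exact (min_le_left _ _).trans (min_le_left _ _)
    · exact (min_le_left _ _).trans (min_le_right _ _)
    · linarith [(min_le_right (min η₁ η₂) _).trans (min_le_left (ε / 2) (ζ / (2 * M ^ 3)))]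
    · have := (min_le_right (min η₁ η₂) _).trans (min_le_right (ε / 2) (ζ / (2 * M ^ 3)))
      rwa [le_div_iff₀' (by positivity)] at this
  obtain ⟨C₁, hC₁A, hC₁, hC₁η⟩ := H₁ η ⟨hη0.le, hη1'⟩
  obtain ⟨C₂, hC₂A, hC₂, hC₂η⟩ := H₂ η ⟨hη0.le, hη2'⟩
  set v₁ : ℝ → ℝ := C₁.indicator fun s => μ₁ s - 1 with hv₁
  set v₂ : ℝ → ℝ := C₂.indicator fun s => 1 - μ₂ s with hv₂
  have hv₁m : Measurable v₁ := (hμ₁.sub_const 1).indicator hC₁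
  have hv₂m : Measurable v₂ := (hμ₂.const_sub 1).indicator hC₂
  have hv₁0 : ∀ s, 0 ≤ v₁ s := indicator_nonneg fun s hs => by linarith [(h₁ s (hC₁A hs)).1]
  have hv₂0 : ∀ s, 0 ≤ v₂ s := indicator_nonneg fun s hs => by linarith [(h₂ s (hC₂A hs)).2.1]
  have hbdd : ∀ {C : Set ℝ} {w : ℝ → ℝ}, MeasurableSet C → C ⊆ Ioc a b → Measurable w →
      (∀ s ∈ C, |w s| ≤ M) → Integrable (C.indicator w) := fun hC hCab hw hwM => by
    rw [integrable_indicator_iff hC]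
    refine Measure.integrableOn_of_bounded (M := M)
      ((measure_mono hCab).trans_lt measure_Ioc_lt_top).ne hw.aestronglyMeasurable ?_
    filter_upwards [ae_restrict_mem hC] with s hs using hwM s hs
  have hv₁i : Integrable v₁ := hbdd hC₁ (hC₁A.trans hA₁ab) (hμ₁.sub_const 1) fun s hs => by
    rw [abs_of_pos (sub_pos.2 (h₁ s (hC₁A hs)).1)]
    linarith [(hM₁ s (hC₁A hs)).2.1]
  have hv₂i : Integrable v₂ := hbdd hC₂ (hC₂A.trans hA₂ab) (hμ₂.const_sub 1) fun s hs => by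
    rw [abs_of_pos (sub_pos.2 (h₂ s (hC₂A hs)).2.1)]
    linarith [(h₂ s (hC₂A hs)).1]
  have hv₁ii : ∀ p q, IntervalIntegrable v₁ volume p q := fun _ _ => hv₁i.intervalIntegrable
  have hv₂ii : ∀ p q, IntervalIntegrable v₂ volume p q := fun _ _ => hv₂i.intervalIntegrable
  have hon₁ : ∀ s ∈ C₁, v₁ s = μ₁ s - 1 ∧ v₂ s = 0 := fun s hs =>
    ⟨indicator_of_mem hs _, indicator_of_notMem
      (fun hs' => disjoint_left.1 hdisj (hC₁A hs) (hC₂A hs')) _⟩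
  have hon₂ : ∀ s ∈ C₂, v₁ s = 0 ∧ v₂ s = 1 - μ₂ s := fun s hs =>
    ⟨indicator_of_notMem (fun hs' => disjoint_left.1 hdisj (hC₁A hs') (hC₂A hs)) _,
      indicator_of_mem hs _⟩
  have hoff : ∀ s, s ∉ C₁ → s ∉ C₂ → v₁ s = 0 ∧ v₂ s = 0 := fun s hs hs' =>
    ⟨indicator_of_notMem hs _, indicator_of_notMem hs' _⟩
  obtain ⟨hI₁, hL₁, hR₁⟩ := integral_mem_Icc_of_support_subset hv₁i hv₁0 hta hbT
    fun s hs => indicator_of_notMem (fun hs' => hs (hA₁ab (hC₁A hs'))) _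
  obtain ⟨hI₂, hL₂, hR₂⟩ := integral_mem_Icc_of_support_subset hv₂i hv₂0 hta hbT
    fun s hs => indicator_of_notMem (fun hs' => hs (hA₂ab (hC₂A hs'))) _
  rw [hC₁η] at hI₁ hR₁
  rw [hC₂η] at hI₂ hR₂
  set ρ : ℝ → ℝ := fun s => 1 + v₁ s - v₂ s with hρdef
  have hρ₁ : ∀ s ∈ C₁, ρ s = μ₁ s := fun s hs => by
    simp only [hρdef, hon₁ s hs]
    ring
  have hρ₂ : ∀ s ∈ C₂, ρ s = μ₂ s := fun s hs => by
    simp only [hρdef, hon₂ s hs]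
    ring
  have hρoff : ∀ s, s ∉ C₁ → s ∉ C₂ → ρ s = 1 := fun s hs hs' => by
    simp only [hρdef, hoff s hs hs']
    ring
  have hM1 : 1 / M ≤ 1 := by rw [div_le_one hM0]; exact hM
  have hρlow : ∀ s, 1 / M ≤ ρ s := fun s => by
    by_cases hs₁ : s ∈ C₁
    · rw [hρ₁ s hs₁]; linarith [(h₁ s (hC₁A hs₁)).1]
    by_cases hs₂ : s ∈ C₂
    · rw [hρ₂ s hs₂]; exact (hM₂ s (hC₂A hs₂)).2.1
    rwa [hρoff s hs₁ hs₂]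
  have hρup : ∀ s, ρ s ≤ M := fun s => by
    by_cases hs₁ : s ∈ C₁
    · rw [hρ₁ s hs₁]; exact (hM₁ s (hC₁A hs₁)).2.1
    by_cases hs₂ : s ∈ C₂
    · rw [hρ₂ s hs₂]; linarith [(h₂ s (hC₂A hs₂)).2.1]
    rwa [hρoff s hs₁ hs₂]
  obtain ⟨e, he, het⟩ := exists_isTimeChange (ρ := ρ)
    ((measurable_const.add hv₁m).sub hv₂m) (by positivity : 0 < 1 / M) hρlow hρup t
  have hes : ∀ s, e s - s = (∫ τ in t..s, v₁ τ) - ∫ τ in t..s, v₂ τ := fun s => by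
    have h1 := he.sub_eq t s
    rw [hρdef, intervalIntegral.integral_sub (intervalIntegrable_const.add (hv₁ii _ _))
      (hv₂ii _ _), intervalIntegral.integral_add intervalIntegrable_const (hv₁ii _ _),
      intervalIntegral.integral_const, smul_eq_mul, mul_one, het] at h1
    linarith
  have heη : ∀ s ∈ Icc t T, |e s - s| ≤ η := fun s hs => by
    rw [hes, abs_le]
    have := hI₁ s hs
    have := hI₂ s hs
    simp only [mem_Icc] at *
    constructor <;> linarith
  have heoff : ∀ s ∈ Icc t T, s ∉ Ioc a b → e s - s = 0 := fun s hs hsab => by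
    rw [hes]
    rcases le_or_gt s a with hsa | hsa
    · rw [hL₁ s ⟨hs.1, hsa⟩, hL₂ s ⟨hs.1, hsa⟩, sub_zero]
    · have hbs : b ≤ s := (not_le.1 fun hle => hsab ⟨hsa, hle⟩).le
      rw [hR₁ s ⟨hbs, hs.2⟩, hR₂ s ⟨hbs, hs.2⟩, sub_self]
  have heT : e T = T := by
    have := hes T
    rw [hR₁ T ⟨hbT, le_rfl⟩, hR₂ T ⟨hbT, le_rfl⟩] at this
    linarith
  have heI : ∀ s ∈ Icc t T, e s ∈ Icc t T := fun s hs =>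
    ⟨het ▸ e.monotone hs.1, heT ▸ e.monotone hs.2⟩
  have hρ1 : ∫ s in t..T, |ρ s - 1| ≤ ε := by
    have habs : ∀ s, |ρ s - 1| ≤ v₁ s + v₂ s := fun s => by
      have := hv₁0 s
      have := hv₂0 s
      simp only [hρdef]
      rw [abs_le]
      constructor <;> linarith
    calc _ ≤ ∫ s in t..T, (v₁ s + v₂ s) := by
          refine intervalIntegral.integral_mono_on htT
            ((he.intervalIntegrable t T).sub intervalIntegrable_const).abs
            ((hv₁ii _ _).add (hv₂ii _ _)) fun s _ => habs s
      _ = 2 * η := by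
          rw [intervalIntegral.integral_add (hv₁ii _ _) (hv₂ii _ _), hR₁ T ⟨hbT, le_rfl⟩,
            hR₂ T ⟨hbT, le_rfl⟩]
          ring
      _ ≤ ε := hηε
  set h' : ℝ → ℝ := fun s => ρ s * ℓ (e s) s (ρ s) with hh'
  -- the integrand after the time change, compared with the original one
  have hkey : ∀ᵐ s ∂(volume : Measure ℝ), s ∈ Icc t T →
      0 ≤ D s 1 ∧ |h' s| ≤ M * M + M * M * η + |ℓ s s 1| + η * D s 1 ∧
      h' s ≤ ℓ s s 1 + (q₁ + M ^ 3 * η) * v₁ s + (-q₂ + M ^ 3 * η) * v₂ s +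
        η * (Ioc a b).indicator (fun s => D s 1) s := by
    filter_upwards [h.abs_sub_le, h.rate_nonneg] with s hs hs0 hsI
    have hD1 := hs0 hsI 1 one_pos
    have hη := heη s hsI
    have hρpos := he.pos s
    have hle := hs hsI (ρ s) hρpos (e s) (heI s hsI) (hη.trans (by linarith))
    have hDρ := hs0 hsI (ρ s) hρpos
    have hDM : s ∈ C₁ ∪ C₂ → D s (ρ s) ≤ M ∧ |ℓ s s (ρ s)| ≤ M := by
      rintro (hsC | hsC)
      · rw [hρ₁ s hsC]
        exact ⟨(hM₁ s (hC₁A hsC)).1, (hM₁ s (hC₁A hsC)).2.2.2⟩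
      · rw [hρ₂ s hsC]
        exact ⟨(hM₂ s (hC₂A hsC)).1, (hM₂ s (hC₂A hsC)).2.2.2⟩
    have hdiff : s ∈ C₁ ∪ C₂ → |h' s - ρ s * ℓ s s (ρ s)| ≤ M * M * η := fun hsC => by
      have : h' s - ρ s * ℓ s s (ρ s) = ρ s * (ℓ (e s) s (ρ s) - ℓ s s (ρ s)) := by
        simp only [hh']; ring
      rw [this, abs_mul, abs_of_pos hρpos]
      calc _ ≤ ρ s * (D s (ρ s) * |e s - s|) := by gcongr
        _ ≤ M * (M * η) := by
          gcongr
          · exact hρup s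
          · exact (hDM hsC).1
        _ = M * M * η := by ring
    have hηD := mul_nonneg hη0.le hD1
    have hind : 0 ≤ η * (Ioc a b).indicator (fun s => D s 1) s :=
      mul_nonneg hη0.le (by by_cases h : s ∈ Ioc a b <;> simp [h, hD1])
    refine ⟨hD1, ?_, ?_⟩
    · by_cases hsC : s ∈ C₁ ∪ C₂
      · have h1 := abs_sub_abs_le_abs_sub (h' s) (ρ s * ℓ s s (ρ s))
        have h2 := hdiff hsC
        have h3 : |ρ s * ℓ s s (ρ s)| ≤ M * M := by
          rw [abs_mul, abs_of_pos hρpos]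
          gcongr
          · exact hρup s
          · exact (hDM hsC).2
        linarith [abs_nonneg (ℓ s s 1)]
      · rw [mem_union, not_or] at hsC
        have hr := hρoff s hsC.1 hsC.2
        rw [hr] at hle
        simp only [hh', hr, one_mul]
        have h1 := abs_sub_abs_le_abs_sub (ℓ (e s) s 1) (ℓ s s 1)
        have h2 : D s 1 * |e s - s| ≤ D s 1 * η := by gcongr
        nlinarith
    · by_cases hs₁ : s ∈ C₁
      · have h1 := (abs_le.1 (hdiff (Or.inl hs₁))).2
        rw [hρ₁ s hs₁] at h1
        rw [(hon₁ s hs₁).1, (hon₁ s hs₁).2]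
        have h2 := (h₁ s (hC₁A hs₁)).2
        have h3 : M * M * η * 1 ≤ M * M * η * (M * (μ₁ s - 1)) := by
          gcongr; exact (hM₁ s (hC₁A hs₁)).2.2.1
        linarith
      by_cases hs₂ : s ∈ C₂
      · have h1 := (abs_le.1 (hdiff (Or.inr hs₂))).2
        rw [hρ₂ s hs₂] at h1
        rw [(hon₂ s hs₂).1, (hon₂ s hs₂).2]
        have h2 := (h₂ s (hC₂A hs₂)).2.2
        have h3 : M * M * η * 1 ≤ M * M * η * (M * (1 - μ₂ s)) := by
          gcongr; exact (hM₂ s (hC₂A hs₂)).2.2.1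
        linarith
      have hr := hρoff s hs₁ hs₂
      rw [hr] at hle
      rw [(hoff s hs₁ hs₂).1, (hoff s hs₁ hs₂).2]
      simp only [hh', hr, one_mul]
      have h1 := (abs_le.1 hle).2
      by_cases hsab : s ∈ Ioc a b
      · rw [indicator_of_mem hsab]
        have h2 : D s 1 * |e s - s| ≤ D s 1 * η := by gcongr
        linarith
      · rw [heoff s hsI hsab] at h1
        rw [indicator_of_notMem hsab]
        simp only [abs_zero, mul_zero] at h1 ⊢
        linarith
  have hkey' : ∀ᵐ s ∂(volume : Measure ℝ).restrict (Ioc t T), s ∈ Icc t T :=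
    (ae_restrict_mem measurableSet_Ioc).mono fun s hs => Ioc_subset_Icc_self hs
  have hcost := h.intervalIntegrable_cost
  have hrate := h.intervalIntegrable_rate
  have hh'm : Measurable h' := by
    have := h.measurable_cost
    have hem : Measurable e := (IsTimeChange.measurableEmbedding e).measurable
    exact he.measurable.mul (this.comp (hem.prodMk (measurable_id.prodMk he.measurable)))
  have hh'i : IntervalIntegrable h' volume t T := by
    refine (((intervalIntegrable_const (c := M * M + M * M * η)).add hcost.abs).add
      (hrate.const_mul η)).mono_fun hh'm.aestronglyMeasurable ?_
    rw [uIoc_of_le htT]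
    filter_upwards [ae_restrict_of_ae hkey, hkey'] with s hs hsI
    rw [Real.norm_eq_abs]
    exact (hs hsI).2.1.trans (le_abs_self _)
  have hind : IntervalIntegrable ((Ioc a b).indicator fun s => D s 1) volume t T := by
    rw [intervalIntegrable_iff_integrableOn_Ioc_of_le htT] at hrate ⊢
    exact hrate.indicator measurableSet_Ioc
  have hindint : ∫ s in t..T, (Ioc a b).indicator (fun s => D s 1) s = ∫ s in a..b, D s 1 := by
    rw [intervalIntegral.integral_of_le htT, intervalIntegral.integral_of_le hab,
      setIntegral_indicator measurableSet_Ioc,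
      inter_eq_right.2 (Ioc_subset_Ioc hta hbT)]
  have hfin := (h.integral_le ρ e he het heT
    (fun s hs => (heη s hs).trans (by linarith)) hρ1 hh'i).trans
    (intervalIntegral.integral_mono_ae_restrict htT hh'i
      (((hcost.add ((hv₁ii t T).const_mul _)).add ((hv₂ii t T).const_mul _)).add
        (hind.const_mul η)) (by
      rw [← restrict_Ioc_eq_restrict_Icc]
      filter_upwards [ae_restrict_of_ae hkey, hkey'] with s hs hsI using (hs hsI).2.2))
  rw [intervalIntegral.integral_add ((hcost.add ((hv₁ii t T).const_mul _)).add
      ((hv₂ii t T).const_mul _)) (hind.const_mul η),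
    intervalIntegral.integral_add (hcost.add ((hv₁ii t T).const_mul _))
      ((hv₂ii t T).const_mul _),
    intervalIntegral.integral_add hcost ((hv₁ii t T).const_mul _),
    intervalIntegral.integral_const_mul, intervalIntegral.integral_const_mul,
    intervalIntegral.integral_const_mul, hR₁ T ⟨hbT, le_rfl⟩, hR₂ T ⟨hbT, le_rfl⟩,
    hindint] at hfin
  have hdiv : 0 ≤ η * ((q₁ + M ^ 3 * η) + (-q₂ + M ^ 3 * η) + ∫ s in a..b, D s 1) := by
    linarith
  have := nonneg_of_mul_nonneg_right hdiv hη0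
  linarith

/-- Speeding up on `A₁` and slowing down on `A₂` cannot lower the cost. -/
theorem slope_le_add_integral (h : IsTimeMinimal ℓ D t T ε) {a b : ℝ} (hta : t ≤ a)
    (hab : a ≤ b) (hbT : b ≤ T) {A₁ A₂ : Set ℝ} (hA₁ : MeasurableSet A₁) (hA₂ : MeasurableSet A₂)
    (hA₁ab : A₁ ⊆ Ioc a b) (hA₂ab : A₂ ⊆ Ioc a b) (hdisj : Disjoint A₁ A₂)
    (hA₁pos : volume A₁ ≠ 0) (hA₂pos : volume A₂ ≠ 0) {μ₁ μ₂ : ℝ → ℝ} (hμ₁ : Measurable μ₁)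
    (hμ₂ : Measurable μ₂) {q₁ q₂ : ℝ}
    (h₁ : ∀ s ∈ A₁, 1 < μ₁ s ∧ μ₁ s * ℓ s s (μ₁ s) - ℓ s s 1 ≤ q₁ * (μ₁ s - 1))
    (h₂ : ∀ s ∈ A₂, 0 < μ₂ s ∧ μ₂ s < 1 ∧
      μ₂ s * ℓ s s (μ₂ s) - ℓ s s 1 ≤ q₂ * (μ₂ s - 1)) :
    q₂ ≤ q₁ + ∫ s in a..b, D s 1 := by
  have hmeas : ∀ {μ : ℝ → ℝ}, Measurable μ → Measurable (fun s => D s (μ s)) ∧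
      Measurable fun s => ℓ s s (μ s) := fun hμ =>
    ⟨h.measurable_rate.comp (measurable_id.prodMk hμ),
      h.measurable_cost.comp (measurable_id.prodMk (measurable_id.prodMk hμ))⟩
  set F₁ : ℝ → ℝ := fun s => |D s (μ₁ s)| + |μ₁ s| + |(μ₁ s - 1)⁻¹| + |ℓ s s (μ₁ s)| with hF₁
  set F₂ : ℝ → ℝ := fun s => |D s (μ₂ s)| + |(μ₂ s)⁻¹| + |(1 - μ₂ s)⁻¹| + |ℓ s s (μ₂ s)| with hF₂
  have hF₁m : Measurable F₁ := (((hmeas hμ₁).1.abs.add hμ₁.abs).add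
    (hμ₁.sub_const 1).inv.abs).add (hmeas hμ₁).2.abs
  have hF₂m : Measurable F₂ := (((hmeas hμ₂).1.abs.add hμ₂.inv.abs).add
    (hμ₂.const_sub 1).inv.abs).add (hmeas hμ₂).2.abs
  obtain ⟨N₁, hN₁⟩ := exists_nat_measure_inter_le_ne_zero hA₁pos F₁
  obtain ⟨N₂, hN₂⟩ := exists_nat_measure_inter_le_ne_zero hA₂pos F₂
  have hN₁0 : (0 : ℝ) ≤ N₁ := N₁.cast_nonneg
  have hN₂0 : (0 : ℝ) ≤ N₂ := N₂.cast_nonneg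
  have hM : (1 : ℝ) ≤ N₁ + N₂ + 1 := by linarith
  have hinv : ∀ {x M : ℝ}, 0 < x → |x⁻¹| ≤ M → 1 ≤ M * x := fun {x M} hx hxM => by
    rw [abs_of_pos (inv_pos.2 hx)] at hxM
    rwa [inv_le_iff_one_le_mul₀ hx] at hxM
  refine h.slope_le_add_integral_of_bounded hta hab hbT
    (hA₁.inter (measurableSet_le hF₁m measurable_const))
    (hA₂.inter (measurableSet_le hF₂m measurable_const))
    (inter_subset_left.trans hA₁ab) (inter_subset_left.trans hA₂ab)
    (hdisj.mono inter_subset_left inter_subset_left) hN₁ hN₂ hμ₁ hμ₂ hM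
    (fun s hs => h₁ s hs.1) (fun s hs => h₂ s hs.1) ?_ ?_
  · rintro s ⟨hsA, hs⟩
    have hs' : F₁ s ≤ N₁ := hs
    simp only [hF₁] at hs'
    have h1 := abs_nonneg (D s (μ₁ s))
    have h2 := abs_nonneg (μ₁ s)
    have h3 := abs_nonneg (μ₁ s - 1)⁻¹
    have h4 := abs_nonneg (ℓ s s (μ₁ s))
    exact ⟨(le_abs_self _).trans (by linarith), (le_abs_self _).trans (by linarith),
      hinv (sub_pos.2 (h₁ s hsA).1) (by linarith), by linarith⟩
  · rintro s ⟨hsA, hs⟩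
    have hs' : F₂ s ≤ N₂ := hs
    simp only [hF₂] at hs'
    have h1 := abs_nonneg (D s (μ₂ s))
    have h2 := abs_nonneg (μ₂ s)⁻¹
    have h3 := abs_nonneg (1 - μ₂ s)⁻¹
    have h4 := abs_nonneg (ℓ s s (μ₂ s))
    refine ⟨(le_abs_self _).trans (by linarith), ?_,
      hinv (sub_pos.2 (h₂ s hsA).2.1) (by linarith), by linarith⟩
    rw [div_le_iff₀' (by linarith)]
    exact hinv (h₂ s hsA).1 (by linarith)

/-- Steep profitable slow-downs and flat profitable speed-ups cannot coexist on non-null sets. -/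
theorem measure_eq_zero_or (h : IsTimeMinimal ℓ D t T ε) {a b : ℝ} (hta : t ≤ a) (hab : a ≤ b)
    (hbT : b ≤ T) {X₁ X₂ : Set ℝ} (hX₁ : MeasurableSet X₁) (hX₂ : MeasurableSet X₂)
    (hX₁ab : X₁ ⊆ Ioc a b) (hX₂ab : X₂ ⊆ Ioc a b) {q₁ q₂ : ℝ}
    (hq : q₁ + ∫ s in a..b, D s 1 < q₂) :
    volume {s | s ∈ X₁ ∧ ∃ μ > 1, μ * ℓ s s μ - ℓ s s 1 ≤ q₁ * (μ - 1)} = 0 ∨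
    volume {s | s ∈ X₂ ∧ ∃ μ ∈ Ioo (0 : ℝ) 1, μ * ℓ s s μ - ℓ s s 1 ≤ q₂ * (μ - 1)} = 0 := by
  by_contra! hne
  have hslope : ∀ q : ℝ, MeasurableSet
      {p : ℝ × ℝ | p.2 * ℓ p.1 p.1 p.2 - ℓ p.1 p.1 1 ≤ q * (p.2 - 1)} := fun q => by
    have hm₁ : Measurable fun p : ℝ × ℝ => ℓ p.1 p.1 p.2 :=
      h.measurable_cost.comp (measurable_fst.prodMk (measurable_fst.prodMk measurable_snd))
    have hm₂ : Measurable fun p : ℝ × ℝ => ℓ p.1 p.1 1 :=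
      h.measurable_cost.comp (measurable_fst.prodMk (measurable_fst.prodMk measurable_const))
    exact measurableSet_le ((measurable_snd.mul hm₁).sub hm₂)
      ((measurable_snd.sub_const 1).const_mul q)
  obtain ⟨E₁, hE₁, hE₁pos, μ₁, hμ₁, hsel₁⟩ := MeasurableSet.exists_measurable_selection
    (G := X₁ ×ˢ Ioi 1 ∩ {p | p.2 * ℓ p.1 p.1 p.2 - ℓ p.1 p.1 1 ≤ q₁ * (p.2 - 1)})
    ((hX₁.prod measurableSet_Ioi).inter (hslope q₁))
    fun h0 => hne.1 (measure_mono_null (fun s hs => by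
      obtain ⟨hs, μ, hμ, hle⟩ := hs
      exact ⟨(s, μ), ⟨⟨hs, hμ⟩, hle⟩, rfl⟩) h0)
  obtain ⟨E₂, hE₂, hE₂pos, μ₂, hμ₂, hsel₂⟩ := MeasurableSet.exists_measurable_selection
    (G := X₂ ×ˢ Ioo 0 1 ∩ {p | p.2 * ℓ p.1 p.1 p.2 - ℓ p.1 p.1 1 ≤ q₂ * (p.2 - 1)})
    ((hX₂.prod measurableSet_Ioo).inter (hslope q₂))
    fun h0 => hne.2 (measure_mono_null (fun s hs => by
      obtain ⟨hs, μ, hμ, hle⟩ := hs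
      exact ⟨(s, μ), ⟨⟨hs, hμ⟩, hle⟩, rfl⟩) h0)
  obtain ⟨C₁, hC₁E, C₂, hC₂E, hC₁, hC₂, hdisj, hC₁pos, hC₂pos⟩ :=
    exists_disjoint_measure_ne_zero hab hE₁ hE₂ (fun s hs => hX₁ab (hsel₁ s hs).1.1)
      hE₁pos hE₂pos
  exact hq.not_ge (h.slope_le_add_integral hta hab hbT hC₁ hC₂
    (fun s hs => hX₁ab (hsel₁ s (hC₁E hs)).1.1) (fun s hs => hX₂ab (hsel₂ s (hC₂E hs)).1.1)
    hdisj hC₁pos hC₂pos hμ₁ hμ₂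
    (fun s hs => ⟨(hsel₁ s (hC₁E hs)).1.2, (hsel₁ s (hC₁E hs)).2⟩)
    (fun s hs => ⟨(hsel₂ s (hC₂E hs)).1.2.1, (hsel₂ s (hC₂E hs)).1.2.2,
      (hsel₂ s (hC₂E hs)).2⟩))

/-- Almost everywhere, `μ ↦ μ * ℓ s s μ` has ordered slopes at `1`. -/
theorem ae_slope_le (h : IsTimeMinimal ℓ D t T ε) :
    ∀ᵐ s ∂(volume : Measure ℝ), s ∈ Ioo t T → ∀ μ₁ > 1, ∀ μ₂ ∈ Ioo (0 : ℝ) 1,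
      (μ₂ * ℓ s s μ₂ - ℓ s s 1) / (μ₂ - 1) ≤ (μ₁ * ℓ s s μ₁ - ℓ s s 1) / (μ₁ - 1) := by
  have hnull : ∀ q₁ q₂ a b : ℚ, ∀ᵐ s ∂(volume : Measure ℝ), t ≤ a → (a : ℝ) ≤ b → (b : ℝ) ≤ T →
      (q₁ : ℝ) + ∫ s in (a : ℝ)..b, D s 1 < q₂ → s ∈ Ioc (a : ℝ) b →
      ¬((∃ μ > 1, μ * ℓ s s μ - ℓ s s 1 ≤ q₁ * (μ - 1)) ∧
        ∃ μ ∈ Ioo (0 : ℝ) 1, μ * ℓ s s μ - ℓ s s 1 ≤ q₂ * (μ - 1)) := by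
    intro q₁ q₂ a b
    by_cases hcond : t ≤ a ∧ (a : ℝ) ≤ b ∧ (b : ℝ) ≤ T ∧
      (q₁ : ℝ) + ∫ s in (a : ℝ)..b, D s 1 < q₂
    · obtain ⟨hta, hab, hbT, hq⟩ := hcond
      rcases h.measure_eq_zero_or hta hab hbT measurableSet_Ioc measurableSet_Ioc
        Subset.rfl Subset.rfl hq with h0 | h0
      · filter_upwards [measure_eq_zero_iff_ae_notMem.1 h0] with s hs _ _ _ _ hsab hex
        exact hs ⟨hsab, hex.1⟩
      · filter_upwards [measure_eq_zero_iff_ae_notMem.1 h0] with s hs _ _ _ _ hsab hex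
        exact hs ⟨hsab, hex.2⟩
    · exact Eventually.of_forall fun s hta hab hbT hq => absurd ⟨hta, hab, hbT, hq⟩ hcond
  simp only [← ae_all_iff] at hnull
  filter_upwards [hnull] with s hs hsI μ₁ hμ₁ μ₂ hμ₂
  by_contra! hlt
  obtain ⟨q₁, hq₁, hq₁'⟩ := exists_rat_btwn hlt
  obtain ⟨q₂, hq₂, hq₂'⟩ := exists_rat_btwn hq₁'
  have hrate := h.intervalIntegrable_rate
  have hcont : ContinuousAt (fun r => ∫ τ in t..r, D τ 1) s := by
    have h1 := intervalIntegral.continuousOn_primitive_interval' (b₁ := t) (b₂ := T) hrate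
      left_mem_uIcc
    rw [uIcc_of_le h.lt.le] at h1
    exact h1.continuousAt (Icc_mem_nhds hsI.1 hsI.2)
  have hq : (0 : ℝ) < (q₂ - q₁) / 2 := by linarith
  obtain ⟨r, hr, hball⟩ := Metric.continuousAt_iff.1 hcont _ hq
  obtain ⟨a, ha, has⟩ := exists_rat_btwn (max_lt hsI.1 (by linarith : s - r < s))
  obtain ⟨b, hsb, hb⟩ := exists_rat_btwn (lt_min hsI.2 (by linarith : s < s + r))
  rw [max_lt_iff] at ha
  rw [lt_min_iff] at hb
  have hda := hball (x := a) (by rw [Real.dist_eq, abs_lt]; constructor <;> linarith)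
  have hdb := hball (x := b) (by rw [Real.dist_eq, abs_lt]; constructor <;> linarith)
  rw [Real.dist_eq, abs_lt] at hda hdb
  have hsplit := intervalIntegral.integral_interval_sub_left
    (hrate.mono_set (uIcc_subset_uIcc left_mem_uIcc
      (Icc_subset_uIcc ⟨(hsI.1.trans hsb).le, hb.1.le⟩)))
    (hrate.mono_set (uIcc_subset_uIcc left_mem_uIcc
      (Icc_subset_uIcc ⟨ha.1.le, (has.trans hsI.2).le⟩)))
  refine hs q₁ q₂ a b ha.1.le (has.trans hsb).le hb.1.le (by rw [← hsplit]; linarith)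
    ⟨has, hsb.le⟩ ⟨⟨μ₁, hμ₁, ?_⟩, μ₂, hμ₂, ?_⟩
  · rw [div_lt_iff₀ (sub_pos.2 hμ₁)] at hq₁
    exact hq₁.le
  · rw [lt_div_iff_of_neg (sub_neg.2 hμ₂.2)] at hq₂'
    exact hq₂'.le

/-- If all the subgradients at `1` of `μ ↦ μ * ℓ s s μ` are at most `P` on `X₁`, at least `Q` on
`X₂`, and `P + ∫ D < Q`, then one of `X₁`, `X₂` is null. -/
theorem measure_eq_zero_or_of_subgradient (h : IsTimeMinimal ℓ D t T ε) {X₁ X₂ : Set ℝ}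
    (hX₁ : MeasurableSet X₁) (hX₂ : MeasurableSet X₂) (hX₁I : X₁ ⊆ Ioo t T) (hX₂I : X₂ ⊆ Ioo t T)
    {P Q : ℝ} (hPQ : P + ∫ s in t..T, D s 1 < Q)
    (hP : ∀ᵐ s ∂(volume : Measure ℝ), s ∈ X₁ → ∀ p,
      (∀ μ > 0, ℓ s s 1 + p * (μ - 1) ≤ μ * ℓ s s μ) → p ≤ P)
    (hQ : ∀ᵐ s ∂(volume : Measure ℝ), s ∈ X₂ → ∀ p,
      (∀ μ > 0, ℓ s s 1 + p * (μ - 1) ≤ μ * ℓ s s μ) → Q ≤ p) :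
    volume X₁ = 0 ∨ volume X₂ = 0 := by
  obtain ⟨ζ, hζ, hζPQ⟩ : ∃ ζ > 0, P + ζ + ∫ s in t..T, D s 1 < Q - ζ :=
    ⟨(Q - (P + ∫ s in t..T, D s 1)) / 3, by linarith, by linarith⟩
  have hsub : ∀ᵐ s ∂(volume : Measure ℝ), s ∈ Ioo t T →
      (∃ p, (∀ μ > 0, ℓ s s 1 + p * (μ - 1) ≤ μ * ℓ s s μ) ∧
        ∀ q > p, ∃ μ > 1, μ * ℓ s s μ - ℓ s s 1 ≤ q * (μ - 1)) ∧
      (∃ p, (∀ μ > 0, ℓ s s 1 + p * (μ - 1) ≤ μ * ℓ s s μ) ∧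
        ∀ q < p, ∃ μ ∈ Ioo (0 : ℝ) 1, μ * ℓ s s μ - ℓ s s 1 ≤ q * (μ - 1)) := by
    filter_upwards [h.ae_slope_le] with s hs hsI
    simpa only [one_mul] using exists_subgradient_of_slope_le (f := fun μ => μ * ℓ s s μ)
      (by simpa only [one_mul] using hs hsI)
  refine (h.measure_eq_zero_or le_rfl h.lt.le le_rfl hX₁ hX₂ (hX₁I.trans Ioo_subset_Ioc_self)
    (hX₂I.trans Ioo_subset_Ioc_self) hζPQ).imp (fun h0 => ?_) fun h0 => ?_
  · rw [measure_eq_zero_iff_ae_notMem] at h0 ⊢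
    filter_upwards [h0, hsub, hP] with s hs0 hs hsP hsX
    obtain ⟨p, hp, hpq⟩ := (hs (hX₁I hsX)).1
    exact hs0 ⟨hsX, hpq _ (by linarith [hsP hsX p hp])⟩
  · rw [measure_eq_zero_iff_ae_notMem] at h0 ⊢
    filter_upwards [h0, hsub, hQ] with s hs0 hs hsQ hsX
    obtain ⟨p, hp, hpq⟩ := (hs (hX₂I hsX)).2
    exact hs0 ⟨hsX, hpq _ (by linarith [hsQ hsX p hp])⟩

end IsTimeMinimal

section TimeChangeOfPairs

variable {n m : ℕ} {t₀ T t : ℝ} {Λ : ℝ → En n → En m → ℝ} {b : En n → (En m →L[ℝ] En n)}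
  {S : Set (En n)} {U : Set (En m)} {g : En n → EReal} {x : En n} {y y' : ℝ → En n}
  {u : ℝ → En m} {ρ : ℝ → ℝ} {e : ℝ ≃o ℝ}

/-- Weak optimality only depends on the values of the trajectory on `[t, T]`. -/
theorem IsWeakOptimal.congr (h : IsWeakOptimal t₀ T (toE Λ) b S U g t x y u) (htT : t ≤ T)
    (hy : EqOn y y' (Icc t T)) : IsWeakOptimal t₀ T (toE Λ) b S U g t x y' u := by
  obtain ⟨⟨hu, hyt, hS, hU, hi, hyint, -, hΛ, hg⟩, ε, hε, hopt⟩ := h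
  have hyT := hy (right_mem_Icc.2 htT)
  have hyt' := hy (left_mem_Icc.2 htT)
  have hsub : ∀ s ∈ Icc t T, uIcc t s ⊆ Icc t T := fun s hs => by
    rw [uIcc_of_le hs.1]
    exact Icc_subset_Icc_right hs.2
  have hsub' : uIcc t T ⊆ Icc t T := hsub T (right_mem_Icc.2 htT)
  refine ⟨⟨hu, hyt' ▸ hyt, fun s hs => hy hs ▸ hS s hs, hU, ?_, fun s hs => ?_,
    Eventually.of_forall fun s _ => EReal.coe_ne_top _, ?_, hyT ▸ hg⟩, ε, hε, ?_⟩
  · exact (intervalIntegrable_congr fun s hs => by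
      simp only [hy (hsub' (uIoc_subset_uIcc hs))]).1 hi
  · rw [← hy hs, hyint s hs]
    congr 1
    exact intervalIntegral.integral_congr fun τ hτ => by simp only [hy (hsub s hs hτ)]
  · exact (intervalIntegrable_congr fun s hs => by
      simp only [hy (hsub' (uIoc_subset_uIcc hs))]).1 hΛ
  · intro z w hzw hle
    have hJ : Jcost T (toE Λ) g t y' u = Jcost T (toE Λ) g t y u := by
      unfold Jcost
      rw [hyT]
      congr 2
      exact intervalIntegral.integral_congr fun τ hτ => by simp only [hy (hsub' hτ)]
    rw [hJ]
    refine hopt z w hzw (le_of_eq_of_le ?_ hle)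
    congr 1 <;> exact intervalIntegral.integral_congr fun τ hτ => by simp only [hy (hsub' hτ)]

theorem OrderIso.apply_mem_Icc_iff (het : e t = t) (heT : e T = T) (s : ℝ) :
    e s ∈ Icc t T ↔ s ∈ Icc t T := by
  conv_rhs => rw [mem_Icc, ← e.le_iff_le, ← e.le_iff_le (y := T), het, heT]
  rfl

/-- The velocity of the reparametrized pair. -/
theorem IsTimeChange.smul_velocity (h : IsTimeChange ρ e) (s : ℝ) :
    ρ s • b (y (e.symm (e s))) ((ρ (e.symm (e s)))⁻¹ • u (e.symm (e s))) = b (y s) (u s) := by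
  rw [e.symm_apply_apply, map_smul, smul_inv_smul₀ (h.pos s).ne']

/-- Admissible pairs are stable under time changes with integrable cost. -/
theorem IsAdmissible.comp_isTimeChange (hy : IsAdmissible t₀ T (toE Λ) b S U g t x y u)
    (htT : t ≤ T) (hUcone : ∀ u ∈ U, ∀ lam : ℝ, 0 < lam → lam • u ∈ U) (h : IsTimeChange ρ e)
    (het : e t = t) (heT : e T = T)
    (hcost : IntervalIntegrable (fun s => ρ s * Λ (e s) (y s) ((ρ s)⁻¹ • u s)) volume t T) :
    IsAdmissible t₀ T (toE Λ) b S U g t x (fun τ => y (e.symm τ))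
      (fun τ => (ρ (e.symm τ))⁻¹ • u (e.symm τ)) := by
  obtain ⟨hu, hyt, hS, hU, hi, hyint, -, -, hg⟩ := hy
  have hem : Measurable e.symm := (IsTimeChange.measurableEmbedding e.symm).measurable
  have het' : e.symm t = t := by rw [e.symm_apply_eq, het]
  have heT' : e.symm T = T := by rw [e.symm_apply_eq, heT]
  refine ⟨(h.measurable.comp hem).inv.smul (hu.comp hem), by simpa only [het'] using hyt,
    fun s hs => hS _ ((OrderIso.apply_mem_Icc_iff het' heT' s).2 hs), ?_, ?_, fun s hs => ?_,
    Eventually.of_forall fun s _ => EReal.coe_ne_top _, ?_, by simpa only [heT'] using hg⟩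
  · rw [← h.ae_comp_iff]
    filter_upwards [hU] with s hs hsI
    rw [e.symm_apply_apply]
    exact hUcone _ (hs ((OrderIso.apply_mem_Icc_iff het heT s).1 hsI)) _ (inv_pos.2 (h.pos s))
  · have := h.intervalIntegrable_comp_iff
      (G := fun τ => b (y (e.symm τ)) ((ρ (e.symm τ))⁻¹ • u (e.symm τ))) htT
    rw [het, heT] at this
    refine this.1 ?_
    simp only [h.smul_velocity]
    exact hi
  · obtain ⟨r, rfl⟩ := e.surjective s
    rw [OrderIso.apply_mem_Icc_iff het heT] at hs
    have := h.integral_comp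
      (fun τ => b (y (e.symm τ)) ((ρ (e.symm τ))⁻¹ • u (e.symm τ))) hs.1
    rw [het] at this
    rw [← this]
    simp only [h.smul_velocity]
    rw [e.symm_apply_apply]
    exact hyint r hs
  · have := h.intervalIntegrable_comp_iff
      (G := fun τ => Λ τ (y (e.symm τ)) ((ρ (e.symm τ))⁻¹ • u (e.symm τ))) htT
    rw [het, heT] at this
    refine this.1 ?_
    simp only [e.symm_apply_apply, smul_eq_mul]
    exact hcost

/-- The `W^{1,1}` distance between an admissible pair and its reparametrization is controlled by
the `L¹` distance of the velocities. -/
theorem IsAdmissible.integral_norm_sub_le (hy : IsAdmissible t₀ T (toE Λ) b S U g t x y u)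
    {y' : ℝ → En n} {u' : ℝ → En m} (hy' : IsAdmissible t₀ T (toE Λ) b S U g t x y' u')
    (htT : t ≤ T) :
    ∫ s in t..T, ‖y' s - y s‖ ≤
      (T - t) * ∫ s in t..T, ‖b (y' s) (u' s) - b (y s) (u s)‖ := by
  obtain ⟨-, -, -, -, hi, hyint, -, -, -⟩ := hy
  obtain ⟨-, -, -, -, hi', hyint', -, -, -⟩ := hy'
  have hpt : ∀ s ∈ Icc t T, ‖y' s - y s‖ ≤
      ∫ τ in t..T, ‖b (y' τ) (u' τ) - b (y τ) (u τ)‖ := fun s hs => by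
    have hsub : uIcc t s ⊆ uIcc t T := uIcc_subset_uIcc left_mem_uIcc (Icc_subset_uIcc hs)
    rw [hyint s hs, hyint' s hs, add_sub_add_left_eq_sub,
      ← intervalIntegral.integral_sub (hi'.mono_set hsub) (hi.mono_set hsub)]
    refine (intervalIntegral.norm_integral_le_integral_norm hs.1).trans ?_
    exact intervalIntegral.integral_mono_interval le_rfl hs.1 hs.2
      (Eventually.of_forall fun τ => norm_nonneg _) (hi'.sub hi).norm
  have hle := intervalIntegral.norm_integral_le_of_norm_le_const (f := fun s => ‖y' s - y s‖)
    (a := t) (b := T) (C := ∫ τ in t..T, ‖b (y' τ) (u' τ) - b (y τ) (u τ)‖) fun s hs => by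
      rw [uIoc_of_le htT] at hs
      rw [norm_norm]
      exact hpt s (Ioc_subset_Icc_self hs)
  rw [abs_of_nonneg (sub_nonneg.2 htT), mul_comm] at hle
  exact (le_abs_self _).trans hle

/-- A weak optimal pair is optimal among its reparametrizations close to itself. -/
theorem IsWeakOptimal.exists_integral_le (hy : IsWeakOptimal t₀ T (toE Λ) b S U g t x y u)
    (htT : t ≤ T) (hUcone : ∀ u ∈ U, ∀ lam : ℝ, 0 < lam → lam • u ∈ U)
    (hgbot : ∀ z, g z ≠ ⊥) :
    ∃ η > 0, ∀ (ρ : ℝ → ℝ) (e : ℝ ≃o ℝ), IsTimeChange ρ e → e t = t → e T = T →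
      (∀ s ∈ Icc t T, |e s - s| ≤ η) → ∫ s in t..T, |ρ s - 1| ≤ η →
      IntervalIntegrable (fun s => ρ s * Λ (e s) (y s) ((ρ s)⁻¹ • u s)) volume t T →
      ∫ s in t..T, Λ s (y s) (u s) ≤ ∫ s in t..T, ρ s * Λ (e s) (y s) ((ρ s)⁻¹ • u s) := by
  obtain ⟨hadm, ε, hε, hopt⟩ := hy
  have hlen : 0 < T - t + 1 := by linarith
  obtain ⟨η, hη, hclose⟩ := IsTimeChange.exists_integral_norm_sub_le htT hadm.2.2.2.2.1
    (div_pos hε hlen)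
  refine ⟨η, hη, fun ρ e h het heT hes hρ hcost => ?_⟩
  have hadm' := hadm.comp_isTimeChange htT hUcone h het heT hcost
  have heT' : e.symm T = T := by rw [e.symm_apply_eq, heT]
  have hvel : ∫ τ in t..T, ‖b (y (e.symm τ)) ((ρ (e.symm τ))⁻¹ • u (e.symm τ)) -
      b (y τ) (u τ)‖ ≤ ε / (T - t + 1) := by
    have hc := h.integral_comp (fun τ => ‖b (y (e.symm τ)) ((ρ (e.symm τ))⁻¹ • u (e.symm τ)) -
      b (y τ) (u τ)‖) htT
    rw [het, heT] at hc
    rw [← hc]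
    refine le_of_eq_of_le ?_ (hclose ρ e h het heT hes hρ)
    congr 1 with s
    rw [smul_eq_mul, ← abs_of_pos (h.pos s), ← Real.norm_eq_abs, ← norm_smul,
      Real.norm_of_nonneg (h.pos s).le, smul_sub, h.smul_velocity]
  have hdist := hadm.integral_norm_sub_le hadm' htT
  have hJ := hopt _ _ hadm' (by
    calc _ ≤ (T - t) * (ε / (T - t + 1)) + ε / (T - t + 1) :=
          add_le_add (hdist.trans (by gcongr)) hvel
      _ = ε := by field_simp)
  have hc := h.integral_comp
    (fun τ => Λ τ (y (e.symm τ)) ((ρ (e.symm τ))⁻¹ • u (e.symm τ))) htT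
  rw [het, heT] at hc
  simp only [Jcost, toE, EReal.toReal_coe, heT', ← hc, e.symm_apply_apply, smul_eq_mul] at hJ
  lift g (y T) to ℝ using ⟨hadm.2.2.2.2.2.2.2.2, hgbot _⟩ with r
  exact le_of_add_le_add_right (by exact_mod_cast hJ)

/-- Weak optimal pairs are stationary under time changes, with a Lipschitz rate given by
Condition (S). -/
theorem IsWeakOptimal.exists_isTimeMinimal (hy : IsWeakOptimal t₀ T (toE Λ) b S U g t x y u)
    (hyc : Continuous y) (ht₀ : t₀ ≤ t) (htT : t < T)
    (hUcone : ∀ u ∈ U, ∀ lam : ℝ, 0 < lam → lam • u ∈ U) (hgbot : ∀ z, g z ≠ ⊥)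
    (hΛmeas : Measurable fun p : ℝ × En n × En m => Λ p.1 p.2.1 p.2.2)
    {κ A εS : ℝ} {γ γ' : ℝ → ℝ} (hS : ConditionS t₀ T (toE Λ) κ A γ εS) (hγ' : Measurable γ')
    (hγγ' : ∀ᵐ s ∂(volume : Measure ℝ), s ∈ Icc t T → γ s = γ' s)
    (hui : IntervalIntegrable (fun s => ‖u s‖) volume t T) :
    ∃ ε, IsTimeMinimal (fun σ s r => Λ σ (y s) (r⁻¹ • u s))
      (fun s r => κ * Λ s (y s) (r⁻¹ • u s) + A * ‖r⁻¹ • u s‖ + γ' s) t T ε := by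
  obtain ⟨η, hη, hopt⟩ := hy.exists_integral_le htT.le hUcone hgbot
  obtain ⟨-, -, hγ, hεS, hlip⟩ := hS
  have hu : Measurable u := hy.1.1
  have hsub : Icc t T ⊆ Icc t₀ T := Icc_subset_Icc_left ht₀
  have hcost : IntervalIntegrable (fun s => Λ s (y s) (u s)) volume t T := hy.1.2.2.2.2.2.2.2.1
  have hm : Measurable fun p : ℝ × ℝ × ℝ => Λ p.1 (y p.2.1) (p.2.2⁻¹ • u p.2.1) :=
    hΛmeas.comp (measurable_fst.prodMk ((hyc.measurable.comp measurable_snd.fst).prodMk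
      (measurable_snd.snd.inv.smul (hu.comp measurable_snd.fst))))
  have hγi : IntervalIntegrable γ' volume t T := by
    have h1 : IntervalIntegrable γ volume t T :=
      (intervalIntegrable_iff_integrableOn_Icc_of_le htT.le).2 (hγ.mono_set hsub)
    refine h1.congr_ae ?_
    rw [uIoc_of_le htT.le]
    filter_upwards [ae_restrict_of_ae hγγ', ae_restrict_mem measurableSet_Ioc] with s hs hsI
    exact hs (Ioc_subset_Icc_self hsI)
  refine ⟨min η εS, htT, lt_min hη hεS, hm, ?_, by simpa using hcost, ?_, ?_, ?_⟩
  · refine ((hm.comp (measurable_fst.prodMk (measurable_fst.prodMk measurable_snd))).const_mul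
      κ |>.add ?_).add (hγ'.comp measurable_fst)
    exact ((measurable_snd.inv.smul (hu.comp measurable_fst)).norm).const_mul A
  · simpa using ((hcost.const_mul κ).add (hui.const_mul A)).add hγi
  · filter_upwards [hlip, hγγ'] with s hs hγs hsI r hr σ hσ hσs
    have h1 := hs (hsub hsI) s σ (y s) (r⁻¹ • u s)
      ⟨⟨by linarith, by linarith⟩, hsub hsI⟩
      ⟨by
        have := abs_le.1 (hσs.trans (min_le_right _ _))
        constructor <;> linarith, hsub hσ⟩ (EReal.coe_ne_top _) (EReal.coe_ne_top _)
    simp only [toE, EReal.toReal_coe] at h1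
    norm_cast at h1
    rw [← hγs hsI]
    linarith
  · intro ρ e h het heT hes hρ hi
    simpa using hopt ρ e h het heT (fun s hs => (hes s hs).trans (min_le_left _ _))
      (hρ.trans (min_le_left _ _)) hi

end TimeChangeOfPairs

section AprioriBounds

variable {n m : ℕ} {t₀ T t B α d θ : ℝ} {Λ : ℝ → En n → En m → ℝ}
  {b : En n → (En m →L[ℝ] En n)} {S : Set (En n)} {U : Set (En m)} {g : En n → EReal} {x : En n}
  {y : ℝ → En n} {u : ℝ → En m}

/-- Admissible trajectories are continuous on `[t, T]`. -/
theorem IsAdmissible.continuousOn (hy : IsAdmissible t₀ T (toE Λ) b S U g t x y u)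
    (htT : t ≤ T) : ContinuousOn y (Icc t T) := by
  obtain ⟨-, -, -, -, hi, hyint, -⟩ := hy
  have h1 := intervalIntegral.continuousOn_primitive_interval' hi left_mem_uIcc
  rw [uIcc_of_le htT] at h1
  exact (continuousOn_const.add h1).congr hyint

/-- A weak optimal pair has a continuous extension of its trajectory. -/
theorem IsWeakOptimal.exists_continuous (hy : IsWeakOptimal t₀ T (toE Λ) b S U g t x y u)
    (htT : t ≤ T) : ∃ z, Continuous z ∧ EqOn y z (Icc t T) ∧
      IsWeakOptimal t₀ T (toE Λ) b S U g t x z u := by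
  have hc : Continuous (IccExtend htT (fun s : Icc t T => y s)) :=
    Continuous.Icc_extend' (continuousOn_iff_continuous_domRestrict.1 (hy.1.continuousOn htT))
  have heq : EqOn y (IccExtend htT (fun s : Icc t T => y s)) (Icc t T) := fun s hs =>
    (IccExtend_of_mem htT (fun s : Icc t T => y s) hs).symm
  exact ⟨_, hc, heq, hy.congr htT heq⟩

/-- The linear growth of the Lagrangian bounds the controls in `L¹`. -/
theorem IsAdmissible.integral_norm_le (hy : IsAdmissible t₀ T (toE Λ) b S U g t x y u)
    (ht₀ : t₀ ≤ t) (htT : t ≤ T) (hα : 0 < α)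
    (hgrowth : ∀ᵐ s ∂(volume : Measure ℝ), s ∈ Icc t₀ T →
      ∀ y : En n, ∀ u ∈ U, α * ‖u‖ - d ≤ Λ s y u)
    (hB : ∫ s in t..T, Λ s (y s) (u s) ≤ B) :
    IntervalIntegrable (fun s => ‖u s‖) volume t T ∧
      ∫ s in t..T, ‖u s‖ ≤ (B + d * (T - t)) / α := by
  obtain ⟨hu, -, -, hU, -, -, -, hΛ, -⟩ := hy
  replace hΛ : IntervalIntegrable (fun s => Λ s (y s) (u s)) volume t T := hΛ
  have hΛi : IntervalIntegrable (fun s => (Λ s (y s) (u s) + d) / α) volume t T :=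
    (hΛ.add intervalIntegrable_const).div_const α
  have hle : ∀ᵐ s ∂(volume : Measure ℝ).restrict (Ioc t T),
      ‖u s‖ ≤ (Λ s (y s) (u s) + d) / α := by
    filter_upwards [ae_restrict_of_ae hgrowth, ae_restrict_of_ae hU,
      ae_restrict_mem measurableSet_Ioc] with s hs hsU hsI
    have hsI' := Ioc_subset_Icc_self hsI
    have := hs ⟨ht₀.trans hsI'.1, hsI'.2⟩ (y s) (u s) (hsU hsI')
    rw [le_div_iff₀' hα]
    linarith
  have hui : IntervalIntegrable (fun s => ‖u s‖) volume t T := by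
    refine hΛi.mono_fun hu.norm.aestronglyMeasurable ?_
    rw [uIoc_of_le htT]
    filter_upwards [hle] with s hs
    rw [norm_norm]
    exact hs.trans (le_abs_self _)
  refine ⟨hui, (intervalIntegral.integral_mono_ae_restrict htT hui hΛi
    (by rwa [← restrict_Ioc_eq_restrict_Icc])).trans ?_⟩
  rw [intervalIntegral.integral_div, intervalIntegral.integral_add hΛ intervalIntegrable_const,
    intervalIntegral.integral_const, smul_eq_mul, mul_comm (T - t)]
  gcongr

/-- Gronwall bound for admissible trajectories. -/
theorem IsAdmissible.norm_le (hy : IsAdmissible t₀ T (toE Λ) b S U g t x y u)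
    (htT : t ≤ T) (hθ : 0 ≤ θ) (hb : ∀ z : En n, ‖b z‖ ≤ θ * (1 + ‖z‖))
    (hui : IntervalIntegrable (fun s => ‖u s‖) volume t T) {N : ℕ}
    (hN : θ * ∫ s in t..T, ‖u s‖ ≤ N / 2) {C : ℝ} (hC : 1 + ‖x‖ ≤ C) :
    ∀ s ∈ Icc t T, ‖y s‖ ≤ 2 ^ N * C := by
  have hcont := hy.continuousOn htT
  obtain ⟨-, -, -, -, hi, hyint, -⟩ := hy
  have hai : IntervalIntegrable (fun s => θ * ‖u s‖) volume t T := hui.const_mul θ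
  have hz : ContinuousOn (fun s => 1 + ‖y s‖) (Icc t T) := continuousOn_const.add hcont.norm
  have hle : ∀ s ∈ Icc t T, 1 + ‖y s‖ ≤ C + ∫ τ in t..s, θ * ‖u τ‖ * (1 + ‖y τ‖) := by
    intro s hs
    have hsub : uIcc t s ⊆ uIcc t T := uIcc_subset_uIcc left_mem_uIcc (Icc_subset_uIcc hs)
    have hsub' : uIcc t s ⊆ Icc t T := by rwa [uIcc_of_le htT] at hsub
    have h1 : ‖∫ τ in t..s, b (y τ) (u τ)‖ ≤ ∫ τ in t..s, θ * ‖u τ‖ * (1 + ‖y τ‖) := by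
      refine (intervalIntegral.norm_integral_le_integral_norm hs.1).trans ?_
      refine intervalIntegral.integral_mono_on hs.1 (hi.mono_set hsub).norm
        ((hai.mono_set hsub).mul_continuousOn (hz.mono hsub')) fun τ _ => ?_
      calc ‖b (y τ) (u τ)‖ ≤ ‖b (y τ)‖ * ‖u τ‖ := (b (y τ)).le_opNorm _
        _ ≤ θ * (1 + ‖y τ‖) * ‖u τ‖ := by gcongr; exact hb _
        _ = θ * ‖u τ‖ * (1 + ‖y τ‖) := by ring
    have h2 := norm_add_le x (∫ τ in t..s, b (y τ) (u τ))
    rw [← hyint s hs] at h2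
    linarith
  intro s hs
  have hN' : ∫ τ in t..s, θ * ‖u τ‖ ≤ N / 2 := by
    refine le_trans ?_ ((intervalIntegral.integral_const_mul θ _).trans_le hN)
    exact intervalIntegral.integral_mono_interval le_rfl hs.1 hs.2
      (Eventually.of_forall fun τ => by positivity) hai
  have := add_integral_mul_le_two_pow_mul (fun s => by positivity) hai hz
    (fun s => by positivity) hle N s hs hN'
  linarith [hle s hs]

/-- A trajectory driven by a bounded control is Lipschitz. -/
theorem IsAdmissible.lipschitzOnWith (hy : IsAdmissible t₀ T (toE Λ) b S U g t x y u)
    (hθ : 0 ≤ θ) (hb : ∀ z : En n, ‖b z‖ ≤ θ * (1 + ‖z‖)) {K ν : ℝ} (hK : 0 ≤ K) (hν : 0 ≤ ν)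
    (hyK : ∀ s ∈ Icc t T, ‖y s‖ ≤ K)
    (huν : ∀ᵐ s ∂(volume : Measure ℝ), s ∈ Icc t T → ‖u s‖ ≤ ν) :
    LipschitzOnWith (θ * (1 + K) * ν).toNNReal y (Icc t T) := by
  obtain ⟨-, -, -, -, hi, hyint, -⟩ := hy
  refine LipschitzOnWith.of_dist_le_mul fun s hs r hr => ?_
  have hsub : ∀ s ∈ Icc t T, uIcc t s ⊆ uIcc t T := fun s hs =>
    uIcc_subset_uIcc left_mem_uIcc (Icc_subset_uIcc hs)
  rw [dist_eq_norm, hyint s hs, hyint r hr, add_sub_add_left_eq_sub,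
    intervalIntegral.integral_interval_sub_left (hi.mono_set (hsub s hs))
      (hi.mono_set (hsub r hr)), Real.coe_toNNReal _ (by positivity), Real.dist_eq]
  refine intervalIntegral.norm_integral_le_of_norm_le_const_ae ?_
  filter_upwards [huν] with τ hτ hτI
  have hτI' : τ ∈ Icc t T := (ordConnected_Icc.uIcc_subset hr hs) (uIoc_subset_uIcc hτI)
  calc ‖b (y τ) (u τ)‖ ≤ ‖b (y τ)‖ * ‖u τ‖ := (b (y τ)).le_opNorm _
    _ ≤ θ * (1 + K) * ν := by
      gcongr
      · refine (hb _).trans ?_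
        gcongr
        exact hyK τ hτI'
      · exact hτ hτI'

end AprioriBounds

/-- Real numbers separating two extended reals with a gap. -/
theorem EReal.exists_real_gap {p q : EReal} {r : ℝ} (h : p + (r : EReal) < q) :
    ∃ P Q : ℝ, p ≤ (P : EReal) ∧ (Q : EReal) ≤ q ∧ P + r < Q := by
  obtain ⟨c, hpc, hcq⟩ := EReal.lt_iff_exists_real_btwn.1 h
  obtain ⟨Q, hcQ, hQq⟩ := EReal.lt_iff_exists_real_btwn.1 hcq
  refine ⟨c - r, Q, ?_, hQq.le, by simpa using hcQ⟩
  induction p with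
  | bot => exact bot_le
  | top => simp at hpc
  | coe p =>
    norm_cast at hpc ⊢
    linarith

/-- `c_t(B)` is nondecreasing in `t`. -/
theorem cB_le_cB {α d T t δ B : ℝ} (hα : 0 < α) (hB : 0 ≤ B) (htδ : t ≤ δ) (hδ : δ < T) :
    cB α d T t B ≤ cB α d T δ B := by
  have h1 : 0 < T - δ := sub_pos.2 hδ
  have h2 : 0 < T - t := by linarith
  unfold cB
  rw [div_le_div_iff₀ (by positivity) (by positivity)]
  have := mul_nonneg (mul_nonneg hα.le hB) (sub_nonneg.2 htδ)
  nlinarith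

theorem distToCompl_toE {n m : ℕ} (χ : Chi) (t₀ T : ℝ) (Λ : ℝ → En n → En m → ℝ)
    (ω : ℝ × En n × En m) : distToCompl χ t₀ T (toE Λ) ω = ⊤ := by
  simp [distToCompl, toE]

theorem mem_subdiffMu_toE {n m : ℕ} {Λ : ℝ → En n → En m → ℝ} {s : ℝ} {y : En n} {u : En m}
    {p : ℝ} : p ∈ subdiffMu (toE Λ) s y u ↔
      ∀ μ > 0, Λ s y u + p * (μ - 1) ≤ μ * Λ s y (μ⁻¹ • u) := by
  refine forall₂_congr fun μ _ => ?_
  rw [mul_comm μ]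
  simp only [toE]
  norm_cast

/-- Boundedness of a weak optimal control from the growth condition at a fixed bound `K` of the
trajectory. -/
theorem IsWeakOptimal.ae_norm_le {n m : ℕ} {t₀ T t α d κ A εS B K ν c : ℝ}
    {Λ : ℝ → En n → En m → ℝ} {b : En n → (En m →L[ℝ] En n)} {S : Set (En n)} {U : Set (En m)}
    {g : En n → EReal} {x : En n} {y : ℝ → En n} {u : ℝ → En m} {γ : ℝ → ℝ} {χ : Chi}
    (hy : IsWeakOptimal t₀ T (toE Λ) b S U g t x y u) (hyc : Continuous y) (ht₀ : t₀ ≤ t)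
    (htT : t < T) (hΛmeas : Measurable fun p : ℝ × En n × En m => Λ p.1 p.2.1 p.2.2)
    (hUcone : ∀ u ∈ U, ∀ lam : ℝ, 0 < lam → lam • u ∈ U) (hgbot : ∀ z, g z ≠ ⊥)
    (hα : 0 < α) (hd : 0 ≤ d)
    (hgrowth : ∀ᵐ s ∂(volume : Measure ℝ), s ∈ Icc t₀ T →
      ∀ y : En n, ∀ u ∈ U, α * ‖u‖ - d ≤ Λ s y u)
    (hS : ConditionS t₀ T (toE Λ) κ A γ εS) (hB : ∫ s in t..T, Λ s (y s) (u s) ≤ B)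
    (hyK : ∀ s ∈ Icc t T, ‖y s‖ ≤ K) (hc : cB α d T t B < c)
    (hgap : sSup (HsupSet t₀ T (toE Λ) U K ν) + ((PhiB α d κ A t₀ T γ B : ℝ) : EReal) <
      sInf (HinfSet χ t₀ T (toE Λ) U K c 1)) :
    ∀ᵐ s ∂(volume : Measure ℝ), s ∈ Icc t T → ‖u s‖ ≤ ν := by
  obtain ⟨hui, hule⟩ := hy.1.integral_norm_le ht₀ htT.le hα hgrowth hB
  have hu : Measurable u := hy.1.1
  have hU := hy.1.2.2.2.1
  obtain ⟨hκ, hA, hγ, -, -⟩ := id hS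
  have hsub : Icc t T ⊆ Icc t₀ T := Icc_subset_Icc_left ht₀
  have hγmk : ∀ᵐ s ∂(volume : Measure ℝ), s ∈ Icc t T →
      γ s = hγ.aestronglyMeasurable.mk γ s := by
    filter_upwards [(ae_restrict_iff' measurableSet_Icc).1 hγ.aestronglyMeasurable.ae_eq_mk]
      with s hs hsI using hs (hsub hsI)
  obtain ⟨ε, hmin⟩ := hy.exists_isTimeMinimal hyc ht₀ htT hUcone hgbot hΛmeas hS
    hγ.aestronglyMeasurable.stronglyMeasurable_mk.measurable hγmk hui
  have hcost : IntervalIntegrable (fun s => Λ s (y s) (u s)) volume t T := hy.1.2.2.2.2.2.2.2.1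
  have hγi₀ : IntervalIntegrable γ volume t₀ T :=
    (intervalIntegrable_iff_integrableOn_Icc_of_le (ht₀.trans htT.le)).2 hγ
  have hγi : IntervalIntegrable γ volume t T :=
    (intervalIntegrable_iff_integrableOn_Icc_of_le htT.le).2 (hγ.mono_set hsub)
  have hrate : ∫ s in t..T, (κ * Λ s (y s) ((1 : ℝ)⁻¹ • u s) + A * ‖(1 : ℝ)⁻¹ • u s‖ +
      hγ.aestronglyMeasurable.mk γ s) ≤ PhiB α d κ A t₀ T γ B := by
    have h1 : ∫ s in t..T, (κ * Λ s (y s) ((1 : ℝ)⁻¹ • u s) + A * ‖(1 : ℝ)⁻¹ • u s‖ +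
        hγ.aestronglyMeasurable.mk γ s) =
        ∫ s in t..T, (κ * Λ s (y s) (u s) + A * ‖u s‖ + γ s) := by
      refine intervalIntegral.integral_congr_ae ?_
      filter_upwards [hγmk] with s hs hsI
      rw [uIoc_of_le htT.le] at hsI
      rw [hs (Ioc_subset_Icc_self hsI), inv_one, one_smul]
    rw [h1, intervalIntegral.integral_add ((hcost.const_mul κ).add (hui.const_mul A)) hγi,
      intervalIntegral.integral_add (hcost.const_mul κ) (hui.const_mul A),
      intervalIntegral.integral_const_mul, intervalIntegral.integral_const_mul]
    have h2 : ∫ s in t..T, γ s ≤ ∫ s in t₀..T, |γ s| :=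
      (intervalIntegral.integral_mono_on htT.le hγi hγi.abs fun s _ => le_abs_self _).trans
        (intervalIntegral.integral_mono_interval ht₀ htT.le le_rfl
          (Eventually.of_forall fun s => abs_nonneg _) hγi₀.abs)
    have h3 : A * ∫ s in t..T, ‖u s‖ ≤ A / α * (B + d * (T - t₀)) := by
      calc _ ≤ A * ((B + d * (T - t)) / α) := by gcongr
        _ = A / α * (B + d * (T - t)) := by ring
        _ ≤ A / α * (B + d * (T - t₀)) := by gcongr
    have h4 : κ * ∫ s in t..T, Λ s (y s) (u s) ≤ κ * B := by gcongr
    unfold PhiB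
    linarith
  obtain ⟨P, Q, hP, hQ, hPQ⟩ := EReal.exists_real_gap hgap
  have hslow : volume (Ioo t T ∩ {s | ‖u s‖ < c}) ≠ 0 := fun h0 => by
    have hle : ∀ᵐ s ∂(volume : Measure ℝ).restrict (Icc t T), c ≤ ‖u s‖ := by
      rw [measure_eq_zero_iff_ae_notMem] at h0
      rw [ae_restrict_iff' measurableSet_Icc]
      filter_upwards [h0, Ioo_ae_eq_Icc (a := t) (b := T) (μ := volume)] with s hs hsI hsI'
      exact not_lt.1 fun hlt => hs ⟨hsI.mpr hsI', hlt⟩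
    have h1 := intervalIntegral.integral_mono_ae_restrict htT.le
      (intervalIntegrable_const (c := c)) hui hle
    rw [intervalIntegral.integral_const, smul_eq_mul] at h1
    have h2 := h1.trans hule
    refine hc.not_ge ?_
    have hTt := sub_pos.2 htT
    unfold cB
    rw [le_div_iff₀ (by positivity)]
    rw [le_div_iff₀ hα] at h2
    linarith
  have hor : volume (Ioo t T ∩ {s | ν < ‖u s‖}) = 0 ∨ volume (Ioo t T ∩ {s | ‖u s‖ < c}) = 0 := by
    refine hmin.measure_eq_zero_or_of_subgradient
      (measurableSet_Ioo.inter (measurableSet_lt measurable_const hu.norm))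
      (measurableSet_Ioo.inter (measurableSet_lt hu.norm measurable_const))
      inter_subset_left inter_subset_left (lt_of_le_of_lt (by gcongr) hPQ) ?_ ?_
    · filter_upwards [hU] with s hs hsX p hp
      have hsI := Ioo_subset_Icc_self hsX.1
      have hmem : (p : EReal) ∈ HsupSet t₀ T (toE Λ) U K ν :=
        ⟨s, hsub hsI, y s, hyK s hsI, u s, hs hsI, hsX.2.le, EReal.coe_ne_top _, p,
          mem_subdiffMu_toE.2 (by simpa using hp), rfl⟩
      exact_mod_cast (le_sSup hmem).trans hP
    · filter_upwards [hU] with s hs hsX p hp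
      have hsI := Ioo_subset_Icc_self hsX.1
      have hmem : (p : EReal) ∈ HinfSet χ t₀ T (toE Λ) U K c 1 :=
        ⟨s, hsub hsI, y s, hyK s hsI, u s, hs hsI, hsX.2, EReal.coe_ne_top _,
          by rw [distToCompl_toE]; exact le_top, p, mem_subdiffMu_toE.2 (by simpa using hp), rfl⟩
      exact_mod_cast hQ.trans (sInf_le hmem)
  rcases hor with h0 | h0
  · rw [measure_eq_zero_iff_ae_notMem] at h0
    filter_upwards [h0, Ioo_ae_eq_Icc (a := t) (b := T) (μ := volume)] with s hs hsI hsI'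
    exact not_lt.1 fun hlt => hs ⟨hsI.mpr hsI', hlt⟩
  · exact absurd h0 hslow

/-- (Uniform L∞-boundedness of optimal controls, real-valued case.)
Assume `Λ` is real valued and satisfies Condition (S); fix `δ ∈ [t₀,T[`, `δ* ≥ 0`,
`x* ∈ ℝⁿ`, `B ≥ 0` and `χ ∈ {e,u,∞}`, and assume the growth condition (H_B^δ(χ)).
Then there are `ν̄ > 0` and a Lipschitz rank `ℓ`, depending only on `δ, B, δ*, x*` and the
problem data, such that every `W^{1,1}`-weak optimal pair `(y_*,u_*)` for (P_{t,x}) with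
`t ∈ [t₀,δ]`, `x ∈ B̄_{δ*}(x*)` and `∫_t^T Λ(s, y_* s, u_* s) ds ≤ B` satisfies
`|u_*(s)| ≤ ν̄` a.e. on `[t,T]` and `y_*` is `ℓ`-Lipschitz on `[t,T]`. -/
theorem stmt0 {n m : ℕ} (hn : 1 ≤ n) (hm : 1 ≤ m)
    (t₀ T : ℝ) (hT : t₀ < T)
    (Λ : ℝ → En n → En m → ℝ)
    (hΛmeas : Measurable fun p : ℝ × En n × En m => Λ p.1 p.2.1 p.2.2)
    (b : En n → (En m →L[ℝ] En n))
    (hbmeas : Measurable fun p : En n × En m => b p.1 p.2)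
    (θ : ℝ) (hθ : 0 ≤ θ) (hb : ∀ z : En n, ‖b z‖ ≤ θ * (1 + ‖z‖))
    (S : Set (En n)) (hSne : S.Nonempty)
    (U : Set (En m)) (hUcone : ∀ u ∈ U, ∀ lam : ℝ, 0 < lam → lam • u ∈ U)
    (g : En n → EReal) (hgbot : ∀ z, g z ≠ ⊥) (hgne : ∃ z, g z ≠ ⊤)
    (α d : ℝ) (hα : 0 < α) (hd : 0 ≤ d)
    (hgrowth : ∀ᵐ s ∂(volume : Measure ℝ), s ∈ Icc t₀ T →
      ∀ y : En n, ∀ u ∈ U, α * ‖u‖ - d ≤ Λ s y u)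
    (κ A : ℝ) (γ : ℝ → ℝ) (εS : ℝ)
    (hCondS : ConditionS t₀ T (toE Λ) κ A γ εS)
    (δ : ℝ) (hδ : δ ∈ Ico t₀ T) (δstar : ℝ) (hδstar : 0 ≤ δstar) (xstar : En n)
    (B : ℝ) (hB : 0 ≤ B) (χ : Chi)
    (hH : ConditionH χ t₀ T α d κ A γ (toE Λ) U δ B) :
    ∃ ν : ℝ, 0 < ν ∧ ∃ ℓ : NNReal,
      ∀ t ∈ Icc t₀ δ, ∀ x ∈ Metric.closedBall xstar δstar,
        ∀ (y : ℝ → En n) (u : ℝ → En m),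
          IsWeakOptimal t₀ T (toE Λ) b S U g t x y u →
          (∫ s in t..T, Λ s (y s) (u s)) ≤ B →
          (∀ᵐ s ∂(volume : Measure ℝ), s ∈ Icc t T → ‖u s‖ ≤ ν) ∧
            LipschitzOnWith ℓ y (Icc t T) := by
  set N : ℕ := ⌈2 * (θ * ((B + d * (T - t₀)) / α))⌉₊ with hN
  set K : ℝ := 2 ^ N * (1 + ‖xstar‖ + δstar) with hK
  have hK0 : 0 ≤ K := by positivity
  obtain ⟨ν, hν, c, hc, hgap⟩ := hH K hK0
  refine ⟨ν, hν, (θ * (1 + K) * ν).toNNReal, fun t ht x hx y u hy hyB => ?_⟩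
  have htT : t < T := ht.2.trans_lt hδ.2
  obtain ⟨z, hzc, hyz, hz⟩ := hy.exists_continuous htT.le
  have hzB : ∫ s in t..T, Λ s (z s) (u s) ≤ B := by
    refine le_of_eq_of_le (intervalIntegral.integral_congr fun s hs => ?_) hyB
    rw [uIcc_of_le htT.le] at hs
    simp only [hyz hs]
  obtain ⟨hui, hule⟩ := hz.1.integral_norm_le ht.1 htT.le hα hgrowth hzB
  have hzK : ∀ s ∈ Icc t T, ‖z s‖ ≤ K := by
    refine hz.1.norm_le htT.le hθ hb hui ?_ ?_
    · have h1 : θ * ∫ s in t..T, ‖u s‖ ≤ θ * ((B + d * (T - t₀)) / α) := by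
        refine mul_le_mul_of_nonneg_left (hule.trans ?_) hθ
        gcongr
        exact ht.1
      have h2 := Nat.le_ceil (2 * (θ * ((B + d * (T - t₀)) / α)))
      rw [← hN] at h2
      linarith
    · have h1 := norm_le_norm_add_norm_sub' x xstar
      rw [mem_closedBall_iff_norm] at hx
      linarith
  have hbound := hz.ae_norm_le hzc ht.1 htT hΛmeas hUcone hgbot hα hd hgrowth hCondS hzB hzK
    ((cB_le_cB hα hB ht.2 hδ.2).trans_lt hc) (hgap 1 one_pos)
  refine ⟨hbound, fun s hs r hr => ?_⟩
  rw [hyz hs, hyz hr]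
  exact hz.1.lipschitzOnWith hθ hb hK0 hν.le hzK hbound hs hr

end
end

section
/- (Upper bound for the supremum of P under local boundedness.) Assume Λ has linear growth from below on 𝒰 (Λ(s,y,u) ≥ α|u| − d, α > 0, d ≥ 0) and that Dom(Λ) is strictly star-shaped in u with respect to the origin. Let K ≥ 0 and suppose there is ν > 0 such that Λ is bounded on ([t₀,T] × B_Kⁿ × B_νᵐ) ∩ Dom(Λ), where B_Kⁿ and B_νᵐ are the closed balls of radii K and ν centered at the origin of ℝⁿ and ℝᵐ. Then the supremum of P over all (s,y,u) with s ∈ [t₀,T], |y| ≤ K, u ∈ 𝒰, |u| ≥ ν, Λ(s,y,u) < +∞ and P ∈ ∂_μ(Λ(s,y,u/μ)μ)_{μ=1} ≠ ∅, is strictly less than +∞; more precisely, it is bounded above by a constant depending only on K and ν. -/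
open MeasureTheory Set

noncomputable section

attribute [local instance] Classical.propDecidable

/-- (Upper bound for the supremum of P under local boundedness.)
If `Λ` has linear growth from below on the cone `U`, `Dom(Λ)` is strictly star-shaped in `u`
w.r.t. the origin, `K ≥ 0` and `Λ` is bounded on `([t₀,T] × B_Kⁿ × B_νᵐ) ∩ Dom(Λ)` for some
`ν > 0`, then the supremum of `P(s,y,u) ∈ ∂_μ(Λ(s,y,u/μ)μ)_{μ=1}` over `s ∈ [t₀,T]`,
`|y| ≤ K`, `u ∈ U`, `|u| ≥ ν`, `Λ(s,y,u) < +∞` is bounded above by a real constant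
(in particular it is `< +∞`). -/
theorem stmt8 {n m : ℕ} (hn : 1 ≤ n) (hm : 1 ≤ m)
    (t₀ T : ℝ) (hT : t₀ < T)
    (Λ : ℝ → En n → En m → EReal)
    (hΛmeas : Measurable fun p : ℝ × En n × En m => Λ p.1 p.2.1 p.2.2)
    (hΛbot : ∀ (s : ℝ) (y : En n) (u : En m), Λ s y u ≠ ⊥)
    (U : Set (En m)) (hUcone : ∀ u ∈ U, ∀ lam : ℝ, 0 < lam → lam • u ∈ U)
    (α d : ℝ) (hα : 0 < α) (hd : 0 ≤ d)
    (hgrowth : ∀ s ∈ Icc t₀ T, ∀ y : En n, ∀ u ∈ U,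
      ((α * ‖u‖ - d : ℝ) : EReal) ≤ Λ s y u)
    (hstar : ∀ (s : ℝ) (y : En n) (u : En m), Λ s y u ≠ ⊤ →
      ∀ r : ℝ, 0 < r → r ≤ 1 → Λ s y (r • u) ≠ ⊤)
    (K : ℝ) (hK : 0 ≤ K) (ν : ℝ) (hν : 0 < ν)
    (M₀ : ℝ)
    (hbdd : ∀ s ∈ Icc t₀ T, ∀ (y : En n) (u : En m), ‖y‖ ≤ K → ‖u‖ ≤ ν →
      Λ s y u ≠ ⊤ → |(Λ s y u).toReal| ≤ M₀) :
    ∃ M : ℝ, sSup (HsupSet t₀ T Λ U K ν) ≤ ((M : ℝ) : EReal) := by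
  refine ⟨2 * M₀ + d, sSup_le ?_⟩
  rintro _ ⟨s, hs, y, hy, u, hu, hνu, htop, p, hp, rfl⟩
  rw [EReal.coe_le_coe_iff]
  -- The scale `μ = 2‖u‖/ν ≥ 2` moves `u` into the ball of radius `ν`.
  obtain ⟨μ, hμ⟩ : ∃ μ : ℝ, μ = 2 * ‖u‖ / ν := ⟨_, rfl⟩
  have hμν : μ * ν = 2 * ‖u‖ := by rw [hμ]; field_simp
  have hμ2 : 2 ≤ μ := by rw [hμ, le_div_iff₀ hν]; linarith
  have hμ0 : 0 < μ := by linarith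
  have hnorm : ‖μ⁻¹ • u‖ ≤ ν := by
    rw [norm_smul, Real.norm_of_nonneg (inv_nonneg.2 hμ0.le), inv_mul_le_iff₀ hμ0]
    linarith [norm_nonneg u]
  have htop' := hstar s y u htop μ⁻¹ (inv_pos.2 hμ0) (inv_le_one_of_one_le₀ (by linarith))
  have hM := hbdd s hs y _ hy hnorm htop'
  have hM0 : 0 ≤ M₀ := (abs_nonneg _).trans hM
  have hsub := hp μ hμ0
  have hlow := hgrowth s hs y u hu
  rw [← EReal.coe_toReal htop (hΛbot s y u)] at hsub hlow
  rw [← EReal.coe_toReal htop' (hΛbot s y _)] at hsub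
  norm_cast at hsub hlow
  have hup := mul_le_mul_of_nonneg_right ((le_abs_self _).trans hM) hμ0.le
  have hαu : 0 ≤ α * ‖u‖ := by positivity
  nlinarith [mul_nonneg hM0 (sub_nonneg.2 hμ2), mul_nonneg hd (sub_nonneg.2 hμ2)]

end
end

section
/- (Change of variable between the two subdifferentials.) Let (s,y,u) ∈ Dom(Λ) and p ∈ ℝ. Then p ∈ ∂_μ(Λ(s,y,u/μ)μ)_{μ=1} if and only if Λ(s,y,u) − p ∈ ∂_r Λ(s,y,ru)_{r=1}. Equivalently: [Λ(s,y,u/μ)μ ≥ Λ(s,y,u) + p(μ−1) for all μ > 0] if and only if [Λ(s,y,ru) ≥ Λ(s,y,u) + (Λ(s,y,u) − p)(r−1) for all r > 0]. -/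
open MeasureTheory Set

noncomputable section

/-- The two subgradient inequalities at a real value `L` correspond under `r = μ⁻¹`. -/
theorem coe_add_le_mul_iff_coe_add_inv_le (L p : ℝ) {μ : ℝ} (hμ : 0 < μ) (X : EReal) :
    (L : EReal) + ((p * (μ - 1) : ℝ) : EReal) ≤ X * (μ : EReal) ↔
      (L : EReal) + (((L - p) * (μ⁻¹ - 1) : ℝ) : EReal) ≤ X := by
  induction X with
  | bot =>
    rw [EReal.bot_mul_coe_of_pos hμ, ← EReal.coe_add, ← EReal.coe_add]
    simp only [le_bot_iff, EReal.coe_ne_bot]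
  | top => simp only [EReal.top_mul_coe_of_pos hμ, le_top]
  | coe x =>
    have key : L + (L - p) * (μ⁻¹ - 1) = (L + p * (μ - 1)) / μ := by
      field_simp
      ring
    norm_cast
    rw [key, div_le_iff₀ hμ]

/-- (Change of variable between the two subdifferentials.)
Let `(s,y,u) ∈ Dom(Λ)` and `p ∈ ℝ`. Then `p ∈ ∂_μ(Λ(s,y,u/μ)μ)_{μ=1}` if and only if
`Λ(s,y,u) − p ∈ ∂_r Λ(s,y,ru)_{r=1}`; equivalently,
`Λ(s,y,u/μ)μ ≥ Λ(s,y,u) + p(μ−1)` for all `μ > 0` iff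
`Λ(s,y,ru) ≥ Λ(s,y,u) + (Λ(s,y,u) − p)(r−1)` for all `r > 0`. -/
theorem stmt12 {n m : ℕ}
    (Λ : ℝ → En n → En m → EReal)
    (s : ℝ) (y : En n) (u : En m)
    (hdom : Λ s y u ≠ ⊤) (hbot : Λ s y u ≠ ⊥) (p : ℝ) :
    (p ∈ subdiffMu Λ s y u ↔ ((Λ s y u).toReal - p) ∈ subdiffR Λ s y u) ∧
      ((∀ μ : ℝ, 0 < μ →
          Λ s y u + ((p * (μ - 1) : ℝ) : EReal) ≤ Λ s y (μ⁻¹ • u) * ((μ : ℝ) : EReal)) ↔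
        (∀ r : ℝ, 0 < r →
          Λ s y u + ((((Λ s y u).toReal - p) * (r - 1) : ℝ) : EReal) ≤ Λ s y (r • u))) := by
  suffices h : p ∈ subdiffMu Λ s y u ↔ ((Λ s y u).toReal - p) ∈ subdiffR Λ s y u from ⟨h, h⟩
  have hL : ((Λ s y u).toReal : EReal) = Λ s y u := EReal.coe_toReal hdom hbot
  have key := fun (μ : ℝ) (hμ : 0 < μ) ↦
    coe_add_le_mul_iff_coe_add_inv_le (Λ s y u).toReal p hμ (Λ s y (μ⁻¹ • u))
  simp only [hL] at key
  constructor
  · intro h r hr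
    simpa only [inv_inv] using (key r⁻¹ (inv_pos.2 hr)).1 (h r⁻¹ (inv_pos.2 hr))
  · intro h μ hμ
    exact (key μ hμ).2 (h μ⁻¹ (inv_pos.2 hμ))

end
end

section
/- (Radial subgradient estimates along rays, used to bound sup P.) Assume Λ has linear growth from below on 𝒰 (Λ(s,y,u) ≥ α|u| − d with α > 0, d ≥ 0, for a.e. s ∈ [t₀,T], all y ∈ ℝⁿ, u ∈ 𝒰) and Dom(Λ) is strictly star-shaped in u with respect to the origin. Let ν > 0, let (s,y,u) ∈ Dom(Λ) with u ∈ 𝒰 and |u| ≥ ν, and let Q ∈ ∂_r Λ(s,y,ru)_{r=1}. Then: (i) Λ(s,y,u) − Q ≤ Λ(s,y, ν u/|u|) − (ν/|u|) Q; (ii) −Q ≤ 2[Λ(s,y, (ν/2) u/|u|) + d]; consequently Λ(s,y,u) − Q ≤ Λ(s,y, ν u/|u|) + 2(ν/|u|)[Λ(s,y,(ν/2) u/|u|) + d]. -/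
open MeasureTheory Set

noncomputable section

/-- (Radial subgradient estimates along rays, used to bound `sup P`.)
Assume linear growth from below on the cone `U` and that `Dom(Λ)` is strictly star-shaped
in `u` w.r.t. the origin. If `ν > 0`, `(s,y,u) ∈ Dom(Λ)`, `u ∈ U`, `|u| ≥ ν` and
`Q ∈ ∂_r Λ(s,y,ru)_{r=1}`, then
(i) `Λ(s,y,u) − Q ≤ Λ(s,y, νu/|u|) − (ν/|u|)Q`;
(ii) `−Q ≤ 2[Λ(s,y,(ν/2)u/|u|) + d]`; consequently
(iii) `Λ(s,y,u) − Q ≤ Λ(s,y, νu/|u|) + 2(ν/|u|)[Λ(s,y,(ν/2)u/|u|) + d]`. -/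
theorem stmt15 {n m : ℕ} (hn : 1 ≤ n) (hm : 1 ≤ m)
    (t₀ T : ℝ) (hT : t₀ < T)
    (Λ : ℝ → En n → En m → EReal)
    (hΛbot : ∀ (s : ℝ) (y : En n) (u : En m), Λ s y u ≠ ⊥)
    (U : Set (En m)) (hUcone : ∀ u ∈ U, ∀ lam : ℝ, 0 < lam → lam • u ∈ U)
    (α d : ℝ) (hα : 0 < α) (hd : 0 ≤ d)
    (hgrowth : ∀ s ∈ Icc t₀ T, ∀ y : En n, ∀ u ∈ U,
      ((α * ‖u‖ - d : ℝ) : EReal) ≤ Λ s y u)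
    (hstar : ∀ (s : ℝ) (y : En n) (u : En m), Λ s y u ≠ ⊤ →
      ∀ r : ℝ, 0 < r → r ≤ 1 → Λ s y (r • u) ≠ ⊤)
    (ν : ℝ) (hν : 0 < ν)
    (s : ℝ) (hs : s ∈ Icc t₀ T) (y : En n) (u : En m)
    (hu : u ∈ U) (hνu : ν ≤ ‖u‖) (hdom : Λ s y u ≠ ⊤)
    (Q : ℝ) (hQ : Q ∈ subdiffR Λ s y u) :
    ((((Λ s y u).toReal - Q : ℝ)) : EReal) ≤
        Λ s y ((ν / ‖u‖) • u) + ((-(ν / ‖u‖ * Q) : ℝ) : EReal) ∧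
      ((-Q : ℝ) : EReal) ≤
        ((2 : ℝ) : EReal) * (Λ s y ((ν / 2 / ‖u‖) • u) + ((d : ℝ) : EReal)) ∧
      (((Λ s y u).toReal - Q : ℝ) : EReal) ≤
        Λ s y ((ν / ‖u‖) • u) +
          ((2 * (ν / ‖u‖) : ℝ) : EReal) *
            (Λ s y ((ν / 2 / ‖u‖) • u) + ((d : ℝ) : EReal)) := by
  have hu0 : 0 < ‖u‖ := hν.trans_le hνu
  have hk0 : 0 < ν / ‖u‖ := div_pos hν hu0
  have hk1 : ν / ‖u‖ ≤ 1 := (div_le_one hu0).2 hνu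
  have hhalf : ν / 2 / ‖u‖ = ν / ‖u‖ / 2 := by ring
  rw [hhalf]
  generalize ν / ‖u‖ = k at hk0 hk1
  have hlow : ∀ v ∈ U, ((-d : ℝ) : EReal) ≤ Λ s y v := fun v hv =>
    (EReal.coe_le_coe_iff.2 (by nlinarith [norm_nonneg v])).trans (hgrowth s hs y v hv)
  have h₀ := hlow u hu
  have h₂ := hlow _ (hUcone u hu (k / 2) (by positivity))
  have hsub₁ := hQ k hk0
  have hsub₂ := hQ (k / 2) (by positivity)
  have hfin₁ := hstar s y u hdom k hk0 hk1
  have hfin₂ := hstar s y u hdom (k / 2) (by positivity) (by linarith)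
  lift Λ s y u to ℝ using ⟨hdom, hΛbot s y u⟩ with a
  lift Λ s y (k • u) to ℝ using ⟨hfin₁, hΛbot _ _ _⟩ with b
  lift Λ s y ((k / 2) • u) to ℝ using ⟨hfin₂, hΛbot _ _ _⟩ with c
  rw [EReal.toReal_coe]
  norm_cast at h₀ h₂ hsub₁ hsub₂ ⊢
  have hQc : -Q ≤ 2 * (c + d) := by
    rcases le_total 0 Q with h | h
    · linarith
    · nlinarith
  exact ⟨by linarith, hQc, by nlinarith⟩

end
end
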